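/- arXiv:1905.00520 — 6 statements merged into one kernel-verified Lean document; each statement's English description precedes it below -/
import Mathlib

section
/- Let G be a finite group with subgroups B and C such that G = BC, i.e. every element of G can be written as b*c with b ∈ B and c ∈ C. If B is core-free in G and C is abelian (commutative), then B ∩ C is the trivial subgroup. -/
/-- If `G = BC` with `B` core-free and `C` abelian, then `B ⊓ C = ⊥`. -/
theorem stmt_0 {G : Type*} [Group G] [Finite G] (B C : Subgroup G)
    (hfact : ∀ g : G, ∃ b ∈ B, ∃ c ∈ C, g = b * c)
    (hBcorefree : ∀ N : Subgroup G, N.Normal → N ≤ B → N = ⊥)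
    (hCcomm : ∀ x ∈ C, ∀ y ∈ C, x * y = y * x) :
    B ⊓ C = ⊥ := by
  have hcore : B.normalCore = ⊥ :=
    hBcorefree _ B.normalCore_normal B.normalCore_le
  rw [eq_bot_iff, ← hcore]
  rintro d ⟨hdB, hdC⟩
  change ∀ g : G, g * d * g⁻¹ ∈ B
  intro g
  obtain ⟨b, hb, c, hc, rfl⟩ := hfact g
  have h : b * c * d * (b * c)⁻¹ = b * d * b⁻¹ := by
    rw [mul_assoc b c d, hCcomm c hc d hdC]
    group
  rw [h]
  exact B.mul_mem (B.mul_mem hb hdB) (B.inv_mem hb)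
end

section
/- Let G be a finite group with trivial soluble radical, and let H be a subgroup of G with soc(G) ≤ H. Then the socle of H (computed in H, viewed as a subgroup of G) equals soc(G), and consequently H also has trivial soluble radical. -/
/-- The socle of a group `G`: the subgroup generated by all minimal normal subgroups. -/
def socle (G : Type*) [Group G] : Subgroup G :=
  sSup {N : Subgroup G | N.Normal ∧ N ≠ ⊥ ∧
    ∀ M : Subgroup G, M.Normal → M ≤ N → M = ⊥ ∨ M = N}

section helpers
variable {G : Type*} [Group G]

/-- `H` acts on `T` by conjugation. -/
def InvBy (H T : Subgroup G) : Prop := ∀ h ∈ H, ∀ t ∈ T, h * t * h⁻¹ ∈ T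

/-- `K` is a minimal normal subgroup of `H`, all inside `G`. -/
def MinN (H K : Subgroup G) : Prop :=
  K ≤ H ∧ InvBy H K ∧ K ≠ ⊥ ∧ ∀ M : Subgroup G, InvBy H M → M ≤ K → M = ⊥ ∨ M = K

/-- The relative socle. -/
def relSoc (H : Subgroup G) : Subgroup G := sSup {K | MinN H K}

lemma InvBy.inf {H A B : Subgroup G} (hA : InvBy H A) (hB : InvBy H B) : InvBy H (A ⊓ B) :=
  fun h hh t ht => ⟨hA h hh t ht.1, hB h hh t ht.2⟩

lemma InvBy.mono {H J A : Subgroup G} (hA : InvBy H A) (h : J ≤ H) : InvBy J A :=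
  fun x hx t ht => hA x (h hx) t ht

lemma InvBy.centralizer {H A : Subgroup G} (hA : InvBy H A) :
    InvBy H (Subgroup.centralizer (A : Set G)) := by
  intro h hh c hc
  rw [Subgroup.mem_centralizer_iff] at hc ⊢
  intro a ha
  have h1 := hA h⁻¹ (H.inv_mem hh) a ha
  have h2 := hc _ h1
  rw [inv_inv] at h2
  calc a * (h * c * h⁻¹) = h * (h⁻¹ * a * h * c) * h⁻¹ := by group
    _ = h * (c * (h⁻¹ * a * h)) * h⁻¹ := by rw [h2]
    _ = _ := by group

lemma exists_MinN [Finite G] {H L : Subgroup G} (hL : L ≠ ⊥) (hLH : L ≤ H) (hi : InvBy H L) :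
    ∃ K, MinN H K ∧ K ≤ L := by
  obtain ⟨K, ⟨hK1, hK2, hK3⟩, hmin⟩ := (Set.toFinite {K : Subgroup G | K ≠ ⊥ ∧ K ≤ L ∧ InvBy H K}).exists_minimal
    ⟨L, hL, le_rfl, hi⟩
  refine ⟨K, ⟨hK2.trans hLH, hK3, hK1, ?_⟩, hK2⟩
  intro M hM hMK
  by_cases h : M = ⊥
  · exact Or.inl h
  · exact Or.inr (le_antisymm hMK (hmin ⟨h, hMK.trans hK2, hM⟩ hMK))

lemma MinN.le_or {H K T : Subgroup G} (hK : MinN H K) (hT : InvBy H T) :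
    K ≤ T ∨ K ⊓ T = ⊥ := by
  rcases hK.2.2.2 _ (hK.2.1.inf hT) inf_le_left with h | h
  · exact Or.inr h
  · exact Or.inl (inf_eq_left.mp h)

lemma le_centralizer_of_disj {H K T : Subgroup G} (hK : InvBy H K) (hT : InvBy H T)
    (hKH : K ≤ H) (hTH : T ≤ H) (hd : K ⊓ T = ⊥) : K ≤ Subgroup.centralizer (T : Set G) := by
  intro k hk
  rw [Subgroup.mem_centralizer_iff]
  intro t ht
  have : k * t * k⁻¹ * t⁻¹ ∈ K ⊓ T := by
    refine ⟨?_, T.mul_mem (hT k (hKH hk) t ht) (T.inv_mem ht)⟩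
    have := K.mul_mem hk (hK t (hTH ht) k⁻¹ (K.inv_mem hk))
    simpa [mul_assoc] using this
  rw [hd, Subgroup.mem_bot] at this
  have h2 : k * t = t * k := by
    rw [mul_inv_eq_one, mul_inv_eq_iff_eq_mul] at this
    exact this
  exact h2.symm

lemma relSoc_le (H : Subgroup G) : relSoc H ≤ H := sSup_le fun _ hK => hK.1

lemma InvBy.iff_map {H T : Subgroup G} :
    InvBy H T ↔ ∀ h ∈ H, T.map (MulAut.conj h).toMonoidHom ≤ T := by
  constructor
  · rintro hi h hh _ ⟨t, ht, rfl⟩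
    exact hi h hh t ht
  · intro hi h hh t ht
    exact hi h hh ⟨t, ht, rfl⟩

lemma MinN.conj {H K N : Subgroup G} (hN : InvBy N H) {g : G} (hg : g ∈ N) (hK : MinN H K) :
    MinN H (K.map (MulAut.conj g).toMonoidHom) := by
  have key : ∀ (x : G), x ∈ N → ∀ M : Subgroup G, InvBy H M →
      InvBy H (M.map (MulAut.conj x).toMonoidHom) := by
    rintro x hx M hM h hh _ ⟨m, hm, rfl⟩
    refine ⟨(x⁻¹ * h * x) * m * (x⁻¹ * h * x)⁻¹, hM _ ?_ m hm, ?_⟩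
    · simpa using hN x⁻¹ (N.inv_mem hx) h hh
    · simp [mul_assoc]
  have inv1 : ∀ M : Subgroup G, (M.map (MulAut.conj g⁻¹).toMonoidHom).map
      (MulAut.conj g).toMonoidHom = M := by
    intro M
    rw [Subgroup.map_map]
    convert Subgroup.map_id M
    ext x; simp [mul_assoc]
  have inv2 : ∀ M : Subgroup G, (M.map (MulAut.conj g).toMonoidHom).map
      (MulAut.conj g⁻¹).toMonoidHom = M := by
    intro M
    rw [Subgroup.map_map]
    convert Subgroup.map_id M
    ext x; simp [mul_assoc]
  refine ⟨?_, key g hg K hK.2.1, ?_, ?_⟩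
  · rintro _ ⟨k, hk, rfl⟩
    exact hN g hg k (hK.1 hk)
  · intro h
    apply hK.2.2.1
    rw [← inv2 K, h, Subgroup.map_bot]
  · intro M hM hMK
    have h1 := Subgroup.map_mono (f := (MulAut.conj g⁻¹).toMonoidHom) hMK
    rw [inv2] at h1
    rcases hK.2.2.2 _ (key g⁻¹ (N.inv_mem hg) M hM) h1 with h | h
    · left; rw [← inv1 M, h, Subgroup.map_bot]
    · right; rw [← inv1 M, h]

lemma relSoc_inv {H N : Subgroup G} (hN : InvBy N H) : InvBy N (relSoc H) := by
  rw [InvBy.iff_map]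
  intro g hg
  rw [Subgroup.map_le_iff_le_comap]
  refine sSup_le fun K hK => ?_
  rw [← Subgroup.map_le_iff_le_comap]
  exact le_sSup (hK.conj hN hg)

lemma InvBy.self (H : Subgroup G) : InvBy H H :=
  fun _ hh _ ht => H.mul_mem (H.mul_mem hh ht) (H.inv_mem hh)

/-- The socle of the socle is the socle. -/
lemma relSoc_relSoc [Finite G] : relSoc (⊤ : Subgroup G) ≤ relSoc (relSoc (⊤ : Subgroup G)) := by
  set S := relSoc (⊤ : Subgroup G) with hS
  have hSi : InvBy ⊤ S := relSoc_inv (InvBy.self ⊤)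
  have hA : InvBy ⊤ (relSoc S) := relSoc_inv hSi
  refine sSup_le fun N hN => ?_
  rcases hN.le_or hA with h | h
  · exact h
  · exfalso
    obtain ⟨K, hK, hKN⟩ := exists_MinN hN.2.2.1 (le_sSup hN : N ≤ S) (hN.2.1.mono le_top)
    apply hK.2.2.1
    rw [eq_bot_iff, ← h]
    exact le_inf hKN (le_sSup hK)

lemma decomp [Finite G] {T : Subgroup G} (hT : T ≤ relSoc ⊤) (hi : InvBy (relSoc ⊤) T) :
    relSoc ⊤ ≤ T ⊔ (Subgroup.centralizer (T : Set G) ⊓ relSoc ⊤) := by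
  refine relSoc_relSoc.trans (sSup_le fun M hM => ?_)
  rcases hM.le_or hi with h | h
  · exact h.trans le_sup_left
  · exact (le_inf (le_centralizer_of_disj hM.2.1 hi hM.1 hT h) hM.1).trans le_sup_right

lemma solv_of_cent {K : Subgroup G} (h : K ≤ Subgroup.centralizer (K : Set G)) :
    Group.IsSolvable K := by
  apply Group.isSolvable_of_comm
  intro a b
  exact Subtype.ext (Subgroup.mem_centralizer_iff.mp (h b.2) a a.2)

lemma centralizer_relSoc [Finite G]
    (hrad : ∀ N : Subgroup G, N.Normal → Group.IsSolvable ↥N → N = ⊥) :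
    Subgroup.centralizer ((relSoc (⊤ : Subgroup G) : Subgroup G) : Set G) = ⊥ := by
  by_contra hne
  obtain ⟨K, hK, hKC⟩ := exists_MinN hne le_top
    (relSoc_inv (InvBy.self (⊤ : Subgroup G))).centralizer
  have hKS : K ≤ relSoc ⊤ := le_sSup hK
  exact hK.2.2.1 (hrad K ⟨fun n hn g => hK.2.1 g trivial n hn⟩
    (solv_of_cent (hKC.trans (Subgroup.centralizer_le hKS))))

lemma inf_centralizer [Finite G]
    (hrad : ∀ N : Subgroup G, N.Normal → Group.IsSolvable ↥N → N = ⊥)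
    {T : Subgroup G} (hT : T ≤ relSoc ⊤) (hi : InvBy (relSoc ⊤) T) :
    T ⊓ Subgroup.centralizer (T : Set G) = ⊥ := by
  rw [eq_bot_iff, ← centralizer_relSoc hrad]
  rw [Subgroup.le_centralizer_iff]
  refine (decomp hT hi).trans (sup_le ?_ ?_)
  · rw [Subgroup.le_centralizer_iff]; exact inf_le_right
  · exact inf_le_left.trans (Subgroup.centralizer_le inf_le_left)

lemma relSoc_eq [Finite G]
    (hrad : ∀ N : Subgroup G, N.Normal → Group.IsSolvable ↥N → N = ⊥)
    {H : Subgroup G} (hH : relSoc ⊤ ≤ H) : relSoc H = relSoc ⊤ := by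
  have hSi : InvBy H (relSoc ⊤) := (relSoc_inv (InvBy.self ⊤)).mono le_top
  have hle : relSoc H ≤ relSoc ⊤ := by
    refine sSup_le fun K hK => ?_
    rcases hK.le_or hSi with h | h
    · exact h
    · exfalso
      apply hK.2.2.1
      rw [eq_bot_iff, ← centralizer_relSoc hrad]
      exact le_centralizer_of_disj hK.2.1 hSi hK.1 hH h
  refine le_antisymm hle ?_
  have hTi : InvBy H (relSoc H) := relSoc_inv (InvBy.self H)
  have hc : Subgroup.centralizer ((relSoc H : Subgroup G) : Set G) ⊓ relSoc ⊤ = ⊥ := by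
    by_contra hne
    obtain ⟨K, hK, hKC⟩ := exists_MinN hne (inf_le_right.trans hH) (hTi.centralizer.inf hSi)
    apply hK.2.2.1
    rw [eq_bot_iff, ← inf_centralizer hrad hle (hTi.mono hH)]
    exact le_inf (le_sSup hK) (hKC.trans inf_le_left)
  have := decomp hle (hTi.mono hH)
  rwa [hc, sup_bot_eq] at this

lemma InvBy.map_subtype {H : Subgroup G} {N : Subgroup H} (hN : N.Normal) :
    InvBy H (N.map H.subtype) := by
  rintro h hh _ ⟨n, hn, rfl⟩
  exact ⟨⟨h, hh⟩ * n * ⟨h, hh⟩⁻¹, hN.conj_mem n hn _, rfl⟩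

lemma InvBy.normal {H M : Subgroup G} (hM : InvBy H M) : (M.subgroupOf H).Normal :=
  ⟨fun n hn g => hM g g.2 n hn⟩

lemma map_socle (H : Subgroup G) : (socle ↥H).map H.subtype = relSoc H := by
  apply le_antisymm
  · rw [Subgroup.map_le_iff_le_comap]
    refine sSup_le fun N hN => ?_
    rw [← Subgroup.map_le_iff_le_comap]
    refine le_sSup ⟨Subgroup.map_subtype_le N, InvBy.map_subtype hN.1, ?_, ?_⟩
    · intro h
      exact hN.2.1 ((Subgroup.map_eq_bot_iff_of_injective N H.subtype_injective).mp h)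
    · intro M hM hMN
      have hMH : M ≤ H := hMN.trans (Subgroup.map_subtype_le N)
      have hMe : (M.subgroupOf H).map H.subtype = M := Subgroup.map_subgroupOf_eq_of_le hMH
      have : M.subgroupOf H ≤ N := by
        rw [← Subgroup.map_le_map_iff_of_injective H.subtype_injective, hMe]; exact hMN
      rcases hN.2.2 _ hM.normal this with h | h
      · left; rw [← hMe, h, Subgroup.map_bot]
      · right; rw [← hMe, h]
  · refine sSup_le fun K hK => ?_
    have hKe : (K.subgroupOf H).map H.subtype = K := Subgroup.map_subgroupOf_eq_of_le hK.1
    rw [← hKe]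
    refine Subgroup.map_mono (le_sSup ⟨hK.2.1.normal, ?_, ?_⟩)
    · intro h
      apply hK.2.2.1
      rw [← hKe, h, Subgroup.map_bot]
    · intro M hM hMK
      have h1 : M.map H.subtype ≤ K := by rw [← hKe]; exact Subgroup.map_mono hMK
      rcases hK.2.2.2 _ (InvBy.map_subtype hM) h1 with h | h
      · left; exact (Subgroup.map_eq_bot_iff_of_injective M H.subtype_injective).mp h
      · right
        apply Subgroup.map_injective H.subtype_injective
        rw [hKe, h]

lemma socle_eq : socle G = relSoc (⊤ : Subgroup G) := by
  have hh : ∀ M : Subgroup G, InvBy ⊤ M ↔ M.Normal := fun M =>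
    ⟨fun h => ⟨fun n hn g => h g trivial n hn⟩, fun h g _ n hn => h.conj_mem n hn g⟩
  unfold socle relSoc MinN
  simp only [hh, le_top, true_and]

lemma no_solvable [Finite G]
    (hrad : ∀ N : Subgroup G, N.Normal → Group.IsSolvable ↥N → N = ⊥)
    {H L : Subgroup G} (hH : relSoc ⊤ ≤ H) (hLH : L ≤ H) (hi : InvBy H L) (hs : Group.IsSolvable L) :
    L = ⊥ := by
  by_contra hne
  obtain ⟨K, hK, hKL⟩ := exists_MinN hne hLH hi
  have hKS : K ≤ relSoc ⊤ := (le_sSup hK : K ≤ relSoc H).trans (relSoc_eq hrad hH).le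
  have hKs : Group.IsSolvable K := Group.isSolvable_of_isSolvable_injective (Subgroup.inclusion_injective hKL)
  have hci : InvBy H ⁅K, K⁆ := by
    rw [InvBy.iff_map]
    intro h hh
    rw [Subgroup.map_commutator]
    have := InvBy.iff_map.mp hK.2.1 h hh
    exact Subgroup.commutator_mono this this
  have hcomm : ⁅K, K⁆ = ⊥ := by
    rcases hK.2.2.2 _ hci (Subgroup.commutator_le_self K) with h | h
    · exact h
    · exfalso
      have hnt : Nontrivial K := K.nontrivial_iff_ne_bot.mpr hK.2.2.1
      have h3 := Group.IsSolvable.commutator_lt_top_of_nontrivial K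
      apply h3.ne
      apply Subgroup.map_injective K.subtype_injective
      rw [Subgroup.map_subtype_commutator, h, ← MonoidHom.range_eq_map, Subgroup.range_subtype]
  apply hK.2.2.1
  rw [eq_bot_iff, ← inf_centralizer hrad hKS (hK.2.1.mono hH)]
  exact le_inf le_rfl (Subgroup.commutator_eq_bot_iff_le_centralizer.mp hcomm)

end helpers

/-- If `G` has trivial soluble radical and `soc(G) ≤ H ≤ G`, then
`soc(H) = soc(G)` and `H` has trivial soluble radical. -/
theorem stmt_1 {G : Type*} [Group G] [Finite G]
    (hrad : ∀ N : Subgroup G, N.Normal → IsSolvable ↥N → N = ⊥)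
    (H : Subgroup G) (hsoc : socle G ≤ H) :
    (socle ↥H).map H.subtype = socle G ∧
      ∀ N : Subgroup ↥H, N.Normal → IsSolvable ↥N → N = ⊥ := by
  rw [socle_eq (G := G)] at hsoc ⊢
  refine ⟨(map_socle H).trans (relSoc_eq hrad hsoc), fun N hN hs => ?_⟩
  have hsol : Group.IsSolvable N := hs
  have h1 : Group.IsSolvable (N.map H.subtype) :=
    Group.isSolvable_of_surjective (H.subtype.subgroupMap_surjective N)
  exact (Subgroup.map_eq_bot_iff_of_injective N H.subtype_injective).mp
    (no_solvable hrad hsoc (Subgroup.map_subtype_le N) (InvBy.map_subtype hN) h1)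
end

section
/- Let G be a finite group and let B be a subgroup of G that is monolithic with monolith A (here A is regarded as a subgroup of G contained in B). If B is not core-free in G (i.e. B contains a nontrivial normal subgroup of G), then A is a normal subgroup of G. -/
/-- If `B ≤ G` is monolithic with monolith `A` and `B` is not
core-free in `G`, then `A` is normal in `G`. -/
theorem stmt_2 {G : Type*} [Group G] [Finite G] (B A : Subgroup G)
    (hAB : A ≤ B) (hAne : A ≠ ⊥)
    (hAnormB : ∀ b ∈ B, ∀ a ∈ A, b * a * b⁻¹ ∈ A)
    (hAmin : ∀ N : Subgroup G, N ≤ B → (∀ b ∈ B, ∀ n ∈ N, b * n * b⁻¹ ∈ N) →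
      N ≠ ⊥ → A ≤ N)
    (hAnonab : ∃ a ∈ A, ∃ a' ∈ A, a * a' ≠ a' * a)
    (hBnotcorefree : ∃ N : Subgroup G, N.Normal ∧ N ≤ B ∧ N ≠ ⊥) :
    A.Normal := by
  obtain ⟨N, hN, hNB, hN1⟩ := hBnotcorefree
  have hAN : A ≤ N := hAmin N hNB (fun b _ n hn => hN.conj_mem n hn b) hN1
  -- the centralizer of `A` in `B` is trivial
  have hC : ∀ x ∈ B, (∀ a ∈ A, x * a = a * x) → x = 1 := by
    by_contra! h
    obtain ⟨x, hxB, hx, hx1⟩ := h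
    have hle : A ≤ B ⊓ Subgroup.centralizer (A : Set G) := by
      apply hAmin _ inf_le_left
      · rintro b hb n ⟨hnB, hnC⟩
        refine ⟨B.mul_mem (B.mul_mem hb hnB) (B.inv_mem hb), ?_⟩
        have hnC' := Subgroup.mem_centralizer_iff.1 hnC
        refine Subgroup.mem_centralizer_iff.2 fun a ha => ?_
        have h1 := hnC' _ (hAnormB b⁻¹ (B.inv_mem hb) a ha)
        calc a * (b * n * b⁻¹) = b * ((b⁻¹ * a * b⁻¹⁻¹) * n) * b⁻¹ := by group
          _ = b * (n * (b⁻¹ * a * b⁻¹⁻¹)) * b⁻¹ := by rw [h1]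
          _ = b * n * b⁻¹ * a := by group
      · intro h0
        apply hx1
        rw [← Subgroup.mem_bot, ← h0]
        exact ⟨hxB, Subgroup.mem_centralizer_iff.2 fun a ha => (hx a ha).symm⟩
    obtain ⟨a, ha, a', ha', hne⟩ := hAnonab
    exact hne (Subgroup.mem_centralizer_iff.1 (hle ha').2 a ha)
  -- a minimal normal subgroup `L` of `N`
  obtain ⟨L, hL⟩ := (Set.toFinite {L : Subgroup G | L ≤ N ∧
    (∀ n ∈ N, ∀ l ∈ L, n * l * n⁻¹ ∈ L) ∧ L ≠ ⊥}).exists_minimal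
      ⟨N, le_rfl, fun n _ l hl => hN.conj_mem l hl n, hN1⟩
  obtain ⟨⟨hLN, hLn, hL1⟩, hmin⟩ := hL
  have key : L ≤ A.normalCore := by
    intro l hl g
    let K : Subgroup G := A.comap (MulAut.conj g).toMonoidHom
    have hK : ∀ k, k ∈ K ↔ g * k * g⁻¹ ∈ A := fun k => by simp [K]
    have hKN : ∀ n ∈ N, ∀ k ∈ K, n * k * n⁻¹ ∈ K := by
      intro n hn k hk
      rw [hK] at hk ⊢
      have := hAnormB _ (hNB (hN.conj_mem n hn g)) _ hk
      convert this using 1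
      group
    have hne : L ⊓ K ≠ ⊥ := by
      intro h0
      obtain ⟨x, hx, hx1⟩ := L.bot_or_exists_ne_one.resolve_left hL1
      apply hx1
      have h1 : g * x * g⁻¹ = 1 := by
        apply hC _ (hNB (hN.conj_mem _ (hLN hx) g))
        intro a ha
        have hk : g⁻¹ * a * g ∈ K := by
          rw [hK]; convert ha using 1; group
        have hkN : g⁻¹ * a * g ∈ N := by
          simpa using hN.conj_mem a (hAN ha) g⁻¹
        have hm : (x : G) * (g⁻¹ * a * g) * (x : G)⁻¹ * (g⁻¹ * a * g)⁻¹ ∈ L ⊓ K := by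
          refine Subgroup.mem_inf.2 ⟨?_, K.mul_mem (hKN _ (hLN hx) _ hk) (K.inv_mem hk)⟩
          have := L.mul_mem hx (hLn _ hkN _ (L.inv_mem hx))
          simpa only [mul_assoc] using this
        rw [h0, Subgroup.mem_bot, mul_inv_eq_one, mul_inv_eq_iff_eq_mul] at hm
        calc g * (x : G) * g⁻¹ * a = g * ((x : G) * (g⁻¹ * a * g)) * g⁻¹ := by group
          _ = g * ((g⁻¹ * a * g) * (x : G)) * g⁻¹ := by rw [hm]
          _ = a * (g * (x : G) * g⁻¹) := by group
      simpa using h1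
    have := hmin (y := L ⊓ K) ⟨inf_le_left.trans hLN, fun n hn k hk =>
      ⟨hLn n hn k hk.1, hKN n hn k hk.2⟩, hne⟩ inf_le_left hl
    exact (hK l).1 this.2
  have hcore : A ≤ A.normalCore := by
    apply hAmin _ (A.normalCore_le.trans hAB)
    · exact fun b _ n hn => (A.normalCore_normal).conj_mem n hn b
    · intro h0
      exact hL1 (le_bot_iff.1 (h0 ▸ key))
  have : A.normalCore = A := le_antisymm A.normalCore_le hcore
  rw [← this]
  exact A.normalCore_normal
end

section
/- Let G be a finite group with subgroups B and C such that G = BC (every element of G is a product b*c with b ∈ B, c ∈ C) and B ∩ C = 1. If N is a normal subgroup of G, then |N| = |BN ∩ C| · |B ∩ N| and |N| = |B ∩ CN| · |C ∩ N|, where BN and CN denote the subgroups generated by B,N and by C,N respectively (these coincide with the setwise products since N is normal). -/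
theorem aux_card {G : Type*} [Group G] (B C H : Subgroup G)
    (hfact : ∀ g : G, ∃ b ∈ B, ∃ c ∈ C, g = b * c)
    (hint : B ⊓ C = ⊥) (hBH : B ≤ H) :
    Nat.card H = Nat.card B * Nat.card ↥(H ⊓ C) := by
  rw [← Nat.card_prod]
  symm
  refine Nat.card_congr (Equiv.ofBijective
    (fun p : B × ↥(H ⊓ C) => (⟨p.1.1 * p.2.1, H.mul_mem (hBH p.1.2) p.2.2.1⟩ : H)) ⟨?_, ?_⟩)
  · rintro ⟨⟨b, hb⟩, ⟨c, hc⟩⟩ ⟨⟨b', hb'⟩, ⟨c', hc'⟩⟩ h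
    have h1 : b * c = b' * c' := congrArg Subtype.val h
    have h2 : b'⁻¹ * b = c' * c⁻¹ := by
      rw [inv_mul_eq_iff_eq_mul, ← mul_assoc, ← h1, mul_inv_cancel_right]
    have h3 : b'⁻¹ * b ∈ B ⊓ C :=
      ⟨B.mul_mem (B.inv_mem hb') hb, h2 ▸ C.mul_mem hc'.2 (C.inv_mem hc.2)⟩
    rw [hint, Subgroup.mem_bot, inv_mul_eq_one] at h3
    subst h3
    have h4 := mul_left_cancel h1
    subst h4
    rfl
  · rintro ⟨g, hg⟩
    obtain ⟨b, hb, c, hc, rfl⟩ := hfact g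
    exact ⟨⟨⟨b, hb⟩, ⟨c, (H.mul_mem_cancel_left (hBH hb)).1 hg, hc⟩⟩, rfl⟩

theorem aux_sup {G : Type*} [Group G] (B N : Subgroup G) [N.Normal] :
    Nat.card ↥(B ⊔ N) * Nat.card ↥(B ⊓ N) = Nat.card B * Nat.card N := by
  have h1 := Subgroup.relIndex_mul_relIndex ⊥ N (B ⊔ N) bot_le le_sup_right
  have h2 := Subgroup.relIndex_mul_relIndex ⊥ (B ⊓ N) B bot_le inf_le_left
  have h3 : (B ⊓ N).relIndex B = N.relIndex (B ⊔ N) := by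
    rw [Subgroup.inf_relIndex_left, Subgroup.relIndex_sup_right]
  simp only [Subgroup.relIndex_bot_left] at h1 h2
  rw [← h1, ← h2, h3]
  ring

theorem aux_half {G : Type*} [Group G] [Finite G] (B C : Subgroup G)
    (hfact : ∀ g : G, ∃ b ∈ B, ∃ c ∈ C, g = b * c)
    (hint : B ⊓ C = ⊥)
    (N : Subgroup G) (hN : N.Normal) :
    Nat.card N = Nat.card ↥((B ⊔ N) ⊓ C) * Nat.card ↥(B ⊓ N) := by
  have h1 := aux_card B C (B ⊔ N) hfact hint le_sup_left
  have h2 := aux_sup B N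
  rw [h1, mul_assoc] at h2
  exact (Nat.eq_of_mul_eq_mul_left Nat.card_pos h2).symm


/-- If `G = BC` with `B ⊓ C = ⊥` and `N ⊴ G`, then
`|N| = |BN ⊓ C| ⬝ |B ⊓ N|` and `|N| = |B ⊓ CN| ⬝ |C ⊓ N|`. -/
theorem stmt_3 {G : Type*} [Group G] [Finite G] (B C : Subgroup G)
    (hfact : ∀ g : G, ∃ b ∈ B, ∃ c ∈ C, g = b * c)
    (hint : B ⊓ C = ⊥)
    (N : Subgroup G) (hN : N.Normal) :
    Nat.card N = Nat.card ↥((B ⊔ N) ⊓ C) * Nat.card ↥(B ⊓ N) ∧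
      Nat.card N = Nat.card ↥(B ⊓ (C ⊔ N)) * Nat.card ↥(C ⊓ N) := by
  refine ⟨aux_half B C hfact hint N hN, ?_⟩
  rw [inf_comm B (C ⊔ N)]
  refine aux_half C B (fun g => ?_) (by rw [inf_comm, hint]) N hN
  obtain ⟨b, hb, c, hc, h⟩ := hfact g⁻¹
  exact ⟨c⁻¹, C.inv_mem hc, b⁻¹, B.inv_mem hb, by rw [← mul_inv_rev, ← h, inv_inv]⟩
end

section
/- Let G be a finite group with subgroups B and Y such that G = BY (every element of G is a product b*y with b ∈ B, y ∈ Y), where B is monolithic with monolith A (regarded as a subgroup of G), Y is cyclic, and Y is core-free in G. Let Z = Y ∩ C_G(A) be the centraliser of A in Y. If B is not core-free in G, then A is normal in G, and either (B = A and Z = 1), or |Z| < |B|/|A| (equivalently, |Z| · |A| < |B|). -/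
/-- The theorem of Baer, by the Alperin and Lyons argument. -/
theorem baer_aux {G : Type*} [Group G] [Finite G] (p : ℕ) [Fact p.Prime] (X : Set G)
    (hconj : ∀ g : G, ∀ x ∈ X, g * x * g⁻¹ ∈ X)
    (hpair : ∀ x ∈ X, ∀ y ∈ X, ∃ P : Subgroup G, IsPGroup p P ∧ x ∈ P ∧ y ∈ P) :
    ∃ P : Subgroup G, P.Normal ∧ IsPGroup p P ∧ X ⊆ P := by
  classical
  by_cases hall : ∀ S T : Sylow p G, X ∩ S ⊆ T
  · obtain ⟨S⟩ : Nonempty (Sylow p G) := inferInstance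
    have hXS : ∀ T : Sylow p G, X ⊆ T := by
      intro T x hx
      obtain ⟨P, hP, hxP, -⟩ := hpair x hx x hx
      obtain ⟨Q, hQ⟩ := hP.exists_le_sylow
      exact hall Q T ⟨hx, hQ hxP⟩
    refine ⟨(S : Subgroup G).normalCore, inferInstance, ?_, ?_⟩
    · exact S.isPGroup'.to_le (Subgroup.normalCore_le _)
    · intro x hx g
      exact hXS S (hconj g x hx)
  · exfalso
    push Not at hall
    obtain ⟨S0, T0, h0⟩ := hall
    obtain ⟨⟨S, T⟩, hST, hmax⟩ := Set.Finite.exists_maximalFor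
      (fun q : Sylow p G × Sylow p G => (X ∩ q.1 ∩ q.2 : Set G).ncard)
      {q : Sylow p G × Sylow p G | ¬ (X ∩ (q.1 : Set G) ⊆ q.2)} (Set.toFinite _) ⟨(S0, T0), h0⟩
    simp only [Set.mem_ofPred_eq] at hST hmax
    have hcard : ∀ S T : Sylow p G, (X ∩ S : Set G).ncard ≤ (X ∩ T : Set G).ncard := by
      intro S T
      obtain ⟨g, rfl⟩ := MulAction.exists_smul_eq G S T
      refine Set.ncard_le_ncard_of_injOn (fun x => g * x * g⁻¹) ?_ ?_ (Set.toFinite _)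
      · rintro x ⟨hx, hxS⟩
        refine ⟨hconj g x hx, ?_⟩
        have : x ∈ (S : Subgroup G) := hxS
        show g * x * g⁻¹ ∈ ((g • S : Sylow p G) : Subgroup G)
        rw [Sylow.coe_subgroup_smul]
        exact Subgroup.smul_mem_pointwise_smul x (MulAut.conj g) _ this
      · intro x _ y _ h
        simpa using h
    have hTS : ¬ (X ∩ (T : Set G) ⊆ S) := by
      intro h
      apply hST
      have h1 : (X ∩ T : Set G) ⊆ X ∩ S := fun x hx => ⟨hx.1, h hx⟩
      have h2 := Set.eq_of_subset_of_ncard_le h1 (hcard S T) (Set.toFinite _)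
      rw [← h2]; exact Set.inter_subset_right
    set I : Set G := X ∩ S ∩ T with hI
    have key : ∀ S T : Sylow p G, X ∩ S ∩ T = I → ¬ (X ∩ (S : Set G) ⊆ T) →
        ∃ x ∈ X, x ∈ S ∧ x ∉ I ∧ ∀ i, i ∈ I ↔ x * i * x⁻¹ ∈ I := by
      intro S T hI hST
      obtain ⟨W, ⟨hWS, hWI⟩, hWmax⟩ := Set.Finite.exists_maximal
        (s := {W : Subgroup G | W ≤ S ∧ X ∩ W = I}) (Set.toFinite _) (by
          refine ⟨Subgroup.closure I, ?_, ?_⟩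
          · rw [Subgroup.closure_le, ← hI]
            exact fun x hx => hx.1.2
          · apply Set.Subset.antisymm
            · have h1 : Subgroup.closure I ≤ (S : Subgroup G) ⊓ T := by
                rw [Subgroup.closure_le, ← hI]
                exact fun x hx => ⟨hx.1.2, hx.2⟩
              rw [← hI]
              rw [← hI] at h1
              exact fun x hx => ⟨⟨hx.1, (h1 hx.2).1⟩, (h1 hx.2).2⟩
            · intro x hx
              refine ⟨?_, Subgroup.subset_closure hx⟩
              rw [← hI] at hx; exact hx.1.1)
      have hne : W ≠ S := by
        rintro rfl
        apply hST
        intro z hz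
        have hz' : z ∈ I := by rw [← hWI]; exact hz
        rw [← hI] at hz'
        exact hz'.2
      have hnil : Group.IsNilpotent S := S.isPGroup'.isNilpotent
      have hnc := Group.normalizerCondition_of_isNilpotent (G := S) (W.subgroupOf S) (by
        rw [lt_top_iff_ne_top, Ne, Subgroup.subgroupOf_eq_top]
        exact fun h => hne (le_antisymm hWS h))
      set V := (Subgroup.normalizer (W.subgroupOf S : Set S)).map (S : Subgroup G).subtype with hV
      have hWV : W < V := by
        have := Subgroup.map_lt_map_iff_of_injective (f := (S : Subgroup G).subtype)
          (Subgroup.subtype_injective _) |>.2 hnc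
        rwa [Subgroup.subgroupOf_map_subtype, inf_eq_left.2 hWS] at this
      have hVS : V ≤ S := by
        rintro _ ⟨x, -, rfl⟩; exact x.2
      have hVI : ∃ x ∈ X, x ∈ V ∧ x ∉ I := by
        by_contra hcon
        push Not at hcon
        refine hWV.not_ge (hWmax ⟨hVS, ?_⟩ hWV.le)
        apply Set.Subset.antisymm
        · exact fun x hx => hcon x hx.1 hx.2
        · rw [← hWI]
          exact fun x hx => ⟨hx.1, hWV.le hx.2⟩
      obtain ⟨x, hxX, hxV, hxI⟩ := hVI
      refine ⟨x, hxX, hVS hxV, hxI, ?_⟩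
      obtain ⟨x', hx', rfl⟩ := hxV
      intro i
      have hWn : ∀ w : G, w ∈ W ↔ x' * w * (x' : G)⁻¹ ∈ W := by
        intro w
        rw [SetLike.mem_coe, Subgroup.mem_normalizer_iff] at hx'
        constructor
        · intro hw
          have := (hx' ⟨w, hWS hw⟩).1 (by simpa [Subgroup.mem_subgroupOf] using hw)
          simpa [Subgroup.mem_subgroupOf] using this
        · intro hw
          have hwS : w ∈ (S : Subgroup G) := by
            have := (S : Subgroup G).mul_mem ((S : Subgroup G).mul_mem
              ((S : Subgroup G).inv_mem x'.2) (hWS hw)) x'.2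
            simpa [mul_assoc] using this
          have := (hx' ⟨w, hwS⟩).2 (by simpa [Subgroup.mem_subgroupOf] using hw)
          simpa [Subgroup.mem_subgroupOf] using this
      rw [← hWI]
      constructor
      · rintro ⟨h1, h2⟩
        exact ⟨hconj _ _ h1, (hWn i).1 h2⟩
      · rintro ⟨h1, h2⟩
        refine ⟨?_, (hWn i).2 h2⟩
        have := hconj (x' : G)⁻¹ _ h1
        simpa [mul_assoc] using this
    obtain ⟨x, hxX, hxS, hxI, hxn⟩ := key S T rfl hST
    obtain ⟨y, hyX, hyT, hyI, hyn⟩ := key T S (by rw [hI]; ext; simp; tauto) hTS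
    obtain ⟨P, hP, hxP, hyP⟩ := hpair x hxX y hyX
    -- the subgroup generated by x, y
    have hQ : IsPGroup p (Subgroup.closure {x, y}) := hP.to_le (by
      rw [Subgroup.closure_le]; rintro z (rfl | rfl) <;> assumption)
    have hD : IsPGroup p (Subgroup.closure I) := S.isPGroup'.to_le (by
      rw [Subgroup.closure_le]; exact fun x hx => hx.1.2)
    have hnorm : Subgroup.closure {x, y} ≤ Subgroup.normalizer (Subgroup.closure I : Set G) := by
      rw [Subgroup.closure_le]
      have aux : ∀ z : G, (∀ i, i ∈ I ↔ z * i * z⁻¹ ∈ I) →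
          z ∈ Subgroup.normalizer (Subgroup.closure I : Set G) := by
        intro z hz
        have h1 : (Subgroup.closure I).map (MulAut.conj z).toMonoidHom = Subgroup.closure I := by
          rw [MonoidHom.map_closure]
          congr 1
          ext i
          constructor
          · rintro ⟨j, hj, rfl⟩
            exact (hz j).1 hj
          · intro hi
            refine ⟨z⁻¹ * i * z, (hz _).2 (by simpa [mul_assoc] using hi), by simp [mul_assoc]⟩
        rw [Subgroup.mem_normalizer_iff]
        intro h
        constructor
        · intro hh
          rw [← h1]; exact ⟨h, hh, rfl⟩
        · intro hh
          rw [← h1] at hh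
          obtain ⟨k, hk, hk2⟩ := hh
          have : k = h := by simpa using hk2
          exact this ▸ hk
      rintro z (rfl | rfl)
      · exact aux _ hxn
      · exact aux _ hyn
    have hR := hQ.to_sup_of_normal_right' hD hnorm
    obtain ⟨R, hR⟩ := hR.exists_le_sylow
    have hxR : x ∈ R := hR (Subgroup.mem_sup_left (Subgroup.subset_closure (by simp)))
    have hyR : y ∈ R := hR (Subgroup.mem_sup_left (Subgroup.subset_closure (by simp)))
    have hIR : I ⊆ R := fun i hi => hR (Subgroup.mem_sup_right (Subgroup.subset_closure hi))
    have hlt : ∀ (U V : Sylow p G) (z : G), I ⊆ X ∩ U ∩ V → z ∈ X → z ∈ U → z ∈ V → z ∉ I →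
        X ∩ (U : Set G) ⊆ V := by
      intro U V z h1 h2 h3 h4 h5
      by_contra hcon
      have h6 : I.ncard < (X ∩ U ∩ V : Set G).ncard :=
        Set.ncard_lt_ncard ⟨h1, fun h => h5 (h ⟨⟨h2, h3⟩, h4⟩)⟩ (Set.toFinite _)
      have h7 := @hmax (U, V) hcon h6.le
      exact absurd h6 (not_lt.2 h7)
    have e1 : X ∩ (S : Set G) ⊆ R :=
      hlt S R x (fun i hi => ⟨hi.1, hIR hi⟩) hxX hxS hxR hxI
    have e2 : X ∩ (R : Set G) ⊆ T :=
      hlt R T y (fun i hi => ⟨⟨hi.1.1, hIR hi⟩, hi.2⟩) hyX hyR hyT hyI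
    exact hST fun z hz => e2 ⟨hz.1, e1 hz⟩

universe u

/-- The theorem of Zenkov on intersections of abelian subgroups. -/
theorem zenkov_aux (p : ℕ) [Fact p.Prime] (n : ℕ) :
    ∀ (G : Type u) [Group G] [Finite G], Nat.card G = n → ∀ (A B : Subgroup G),
    (∀ a ∈ A, ∀ b ∈ A, a * b = b * a) → (∀ a ∈ B, ∀ b ∈ B, a * b = b * a) →
    (∀ g : G, (∀ z ∈ A, g⁻¹ * z * g ∈ B → z ∈ B) → ∀ z ∈ A, z ∈ B → g⁻¹ * z * g ∈ B) →
    ∀ x ∈ A, x ∈ B → x ^ p = 1 → ∃ P : Subgroup G, P.Normal ∧ IsPGroup p P ∧ x ∈ P := by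
  induction n using Nat.strong_induction_on with
  | _ n ih =>
  intro G _ _ hn A B hA hB hmin x hxA hxB hxp
  have hzp : ∀ y : G, y ^ p = 1 → IsPGroup p (Subgroup.zpowers y) := by
    intro y hy
    have h1 : orderOf y ∣ p ^ 1 := by
      rw [pow_one]; exact orderOf_dvd_of_pow_eq_one hy
    obtain ⟨k, -, hk⟩ := (Nat.dvd_prime_pow Fact.out).1 h1
    exact IsPGroup.of_card (n := k) (by rw [Nat.card_zpowers, hk])
  by_cases hgen : ∃ g : G, A ⊔ B.map (MulAut.conj g).toMonoidHom = ⊤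
  · obtain ⟨g, hg⟩ := hgen
    have hcent : ∀ d ∈ A, g⁻¹ * d * g ∈ B → d ∈ Subgroup.center G := by
      intro d hdA hdB
      have h1 : A ⊔ B.map (MulAut.conj g).toMonoidHom ≤ Subgroup.centralizer {d} := by
        rw [sup_le_iff]
        constructor
        · intro a ha
          rw [Subgroup.mem_centralizer_singleton_iff]
          exact (hA _ ha _ hdA)
        · rintro _ ⟨b, hb, rfl⟩
          rw [Subgroup.mem_centralizer_singleton_iff]
          have := hB b hb _ hdB
          have h2 : g * (b * (g⁻¹ * d * g)) * g⁻¹ = g * ((g⁻¹ * d * g) * b) * g⁻¹ := by rw [this]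
          simpa [mul_assoc] using h2
      rw [hg] at h1
      rw [Subgroup.mem_center_iff]
      intro z
      have := h1 (Subgroup.mem_top z)
      rw [Subgroup.mem_centralizer_singleton_iff] at this
      exact this
    have hfix : ∀ d ∈ Subgroup.center G, g⁻¹ * d * g = d := by
      intro d hd
      rw [Subgroup.mem_center_iff] at hd
      rw [hd, mul_assoc]; simp
    have hxc : x ∈ Subgroup.center G := by
      apply hcent x hxA
      apply hmin g _ x hxA hxB
      intro z hzA hzB
      have := hfix z (hcent z hzA hzB)
      rwa [this] at hzB
    refine ⟨Subgroup.zpowers x, ?_, hzp x hxp, Subgroup.mem_zpowers x⟩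
    refine ⟨fun z hz g => ?_⟩
    have hzc : z ∈ Subgroup.center G := (Subgroup.zpowers_le.2 hxc) hz
    rw [Subgroup.mem_center_iff] at hzc
    rw [hzc, mul_assoc]; simpa using hz
  · push Not at hgen
    have hstep : ∀ g : G, ∃ P : Subgroup G, IsPGroup p P ∧ x ∈ P ∧ g * x * g⁻¹ ∈ P := by
      intro g
      set H := A ⊔ B.map (MulAut.conj g).toMonoidHom with hH
      have hHlt : Nat.card H < n := by
        rw [← hn]
        refine lt_of_le_of_ne (Subgroup.card_le_card_group H) ?_
        intro h
        exact hgen g (Subgroup.eq_top_of_card_eq _ h)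
      have hAH : A ≤ H := le_sup_left
      have hBH : ∀ b ∈ B, g * b * g⁻¹ ∈ H := fun b hb =>
        (le_sup_right : _ ≤ H) ⟨b, hb, rfl⟩
      obtain ⟨P, hPn, hPp, hxP⟩ := ih (Nat.card H) hHlt H rfl (A.subgroupOf H) (B.subgroupOf H)
        (by
          intro a ha b hb
          exact Subtype.ext (hA a ha b hb))
        (by
          intro a ha b hb
          exact Subtype.ext (hB a ha b hb))
        (by
          intro h hh z hzA hzB
          refine hmin h ?_ z hzA hzB
          intro w hwA hwB
          exact hh ⟨w, hAH hwA⟩ hwA hwB)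
        ⟨x, hAH hxA⟩ hxA hxB (Subtype.ext hxp)
      set y : H := ⟨g * x * g⁻¹, hBH x hxB⟩
      have hyp : y ^ p = 1 := by
        apply Subtype.ext
        show (g * x * g⁻¹) ^ p = 1
        rw [conj_pow, hxp]; simp
      have hyP : IsPGroup p (Subgroup.zpowers y) := by
        have h1 : orderOf y ∣ p ^ 1 := by
          rw [pow_one]; exact orderOf_dvd_of_pow_eq_one hyp
        obtain ⟨k, -, hk⟩ := (Nat.dvd_prime_pow Fact.out).1 h1
        exact IsPGroup.of_card (n := k) (by rw [Nat.card_zpowers, hk])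
      have hQ := (hyP.to_sup_of_normal_right hPp).map H.subtype
      refine ⟨_, hQ, ?_, ?_⟩
      · exact ⟨⟨x, hAH hxA⟩, Subgroup.mem_sup_right hxP, rfl⟩
      · exact ⟨y, Subgroup.mem_sup_left (Subgroup.mem_zpowers y), rfl⟩
    obtain ⟨P, h1, h2, h3⟩ := baer_aux p {z : G | ∃ g, z = g * x * g⁻¹}
      (by
        rintro g _ ⟨h, rfl⟩
        exact ⟨g * h, by simp [mul_assoc]⟩)
      (by
        rintro _ ⟨g, rfl⟩ _ ⟨h, rfl⟩
        obtain ⟨P, hP, h1, h2⟩ := hstep (g⁻¹ * h)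
        refine ⟨P.map (MulAut.conj g).toMonoidHom, hP.map _, ⟨x, h1, rfl⟩,
          ⟨_, h2, by simp [mul_assoc]⟩⟩)
    exact ⟨P, h1, h2, h3 ⟨1, by simp⟩⟩

theorem cyc_sub_normal {G : Type*} [Group G] (C W : Subgroup G) [hC : C.Normal]
    (hcyc : IsCyclic C) (hW : W ≤ C) : W.Normal := by
  obtain ⟨⟨c, hc⟩, hgen⟩ := hcyc.exists_generator
  have hg : ∀ w ∈ C, ∃ k : ℤ, c ^ k = w := by
    intro w hw
    obtain ⟨k, hk⟩ := hgen ⟨w, hw⟩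
    exact ⟨k, congrArg Subtype.val hk⟩
  refine ⟨fun w hw g => ?_⟩
  obtain ⟨j, rfl⟩ := hg w (hW hw)
  obtain ⟨m, hm⟩ := hg _ (hC.conj_mem c hc g)
  rw [← conj_zpow, ← hm, ← zpow_mul, mul_comm, zpow_mul]
  exact W.zpow_mem hw m

/-- If `K ≤ Y E` with `Y` cyclic and `K`, `E` normal, then `W E` is normal for `W ≤ Y ∩ K`. -/
theorem sup_normal_aux {G : Type*} [Group G] (Y E K W : Subgroup G) [hE : E.Normal] [hK : K.Normal]
    (hY : IsCyclic Y) (hKY : K ≤ Y ⊔ E) (hWK : W ≤ K) : (W ⊔ E).Normal := by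
  have hs := QuotientGroup.mk'_surjective E
  have h1 : (K.map (QuotientGroup.mk' E)).Normal := hK.map _ hs
  have h2 : K.map (QuotientGroup.mk' E) ≤ Y.map (QuotientGroup.mk' E) := by
    refine (Subgroup.map_mono hKY).trans ?_
    rw [Subgroup.map_sup, QuotientGroup.map_mk'_self, sup_bot_eq]
  have h3 : IsCyclic (Y.map (QuotientGroup.mk' E)) :=
    isCyclic_of_surjective _ ((QuotientGroup.mk' E).subgroupMap_surjective Y)
  have h4 : IsCyclic (K.map (QuotientGroup.mk' E)) :=
    isCyclic_of_injective _ (Subgroup.inclusion_injective h2)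
  have h5 := cyc_sub_normal _ (W.map (QuotientGroup.mk' E)) h4 (Subgroup.map_mono hWK)
  have h6 : (W ⊔ E) = (W.map (QuotientGroup.mk' E)).comap (QuotientGroup.mk' E) := by
    rw [Subgroup.comap_map_eq, QuotientGroup.ker_mk']
  rw [h6]
  exact h5.comap _

/-- A normal `D` with `D ∩ E = 1`, and `Y` core-free cyclic: `Y ∩ D ∩ K = 1`. -/
theorem inf_triv_aux {G : Type*} [Group G] (Y E K D : Subgroup G) [hE : E.Normal] [hK : K.Normal]
    [hD : D.Normal] (hY : IsCyclic Y) (hKY : K ≤ Y ⊔ E) (hDE : D ⊓ E = ⊥)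
    (hcf : ∀ N : Subgroup G, N.Normal → N ≤ Y → N = ⊥) : Y ⊓ D ⊓ K = ⊥ := by
  have h1 := sup_normal_aux Y E K (Y ⊓ D ⊓ K) hY hKY inf_le_right
  have h2 : (Y ⊓ D ⊓ K ⊔ E) ⊓ D = Y ⊓ D ⊓ K := by
    apply le_antisymm
    · rintro z ⟨hz, hzD⟩
      obtain ⟨w, hw, e, he, rfl⟩ := Subgroup.mem_sup_of_normal_right.1 hz
      have h3 : e ∈ D := by
        have := D.mul_mem (D.inv_mem hw.1.2) hzD
        simpa using this
      have h4 : e ∈ D ⊓ E := ⟨h3, he⟩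
      rw [hDE, Subgroup.mem_bot] at h4
      rw [h4, mul_one]; exact hw
    · exact le_inf le_sup_left (inf_le_left.trans inf_le_right)
  apply hcf _ _ (inf_le_left.trans inf_le_left)
  rw [← h2]
  infer_instance

theorem card_mul_le_aux {G : Type*} [Group G] [Finite G] (H K : Subgroup G) (h : H ⊓ K = ⊥) :
    Nat.card H * Nat.card K ≤ Nat.card G := by
  rw [← Nat.card_prod]
  exact Nat.card_le_card_of_injective _ (Subgroup.mul_injective_of_disjoint (disjoint_iff.2 h))

/-- conjugates of a large subgroup intersect nontrivially -/
theorem conj_inf_aux {G : Type*} [Group G] [Finite G] (A : Subgroup G) (hA : A ≠ ⊤)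
    (hle : Nat.card G ≤ Nat.card A * Nat.card A) (g : G) :
    ∃ z ∈ A, z ≠ 1 ∧ g⁻¹ * z * g ∈ A := by
  by_contra hcon
  push Not at hcon
  have hinj : Function.Injective (fun q : A × A => (q.1 : G) * (g * q.2 * g⁻¹)) := by
    rintro ⟨a, b⟩ ⟨c, d⟩ h
    simp only at h
    have h1 : (c : G)⁻¹ * a = g * (d * (b : G)⁻¹) * g⁻¹ := by
      have : (c : G)⁻¹ * (a * (g * b * g⁻¹)) * (g * (b : G)⁻¹ * g⁻¹) =
        (c : G)⁻¹ * (c * (g * d * g⁻¹)) * (g * (b : G)⁻¹ * g⁻¹) := by rw [h]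
      simpa [mul_assoc] using this
    have h2 : (c : G)⁻¹ * a = 1 := by
      by_contra h3
      refine hcon _ (A.mul_mem (A.inv_mem c.2) a.2) h3 ?_
      rw [h1]
      simpa [mul_assoc] using A.mul_mem d.2 (A.inv_mem b.2)
    have h3 : a = c := Subtype.ext (inv_mul_eq_one.1 h2).symm
    rw [h2] at h1
    have h4 : (d : G) * (b : G)⁻¹ = 1 := by
      have : g⁻¹ * 1 * g = g⁻¹ * (g * (d * (b : G)⁻¹) * g⁻¹) * g := by rw [← h1]
      simpa [mul_assoc] using this.symm
    have h5 : b = d := Subtype.ext (mul_inv_eq_one.1 h4).symm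
    rw [h3, h5]
  have hbij := (Nat.bijective_iff_injective_and_card _).2 ⟨hinj, by
    apply le_antisymm
    · exact Nat.card_le_card_of_injective _ hinj
    · rw [Nat.card_prod]; exact hle⟩
  obtain ⟨⟨a, b⟩, hab⟩ := hbij.2 g⁻¹
  simp only at hab
  have hg : g ∈ A := by
    have h1 : (a : G) * g * b = 1 := by
      have : (a : G) * (g * b * g⁻¹) * g = g⁻¹ * g := by rw [hab]
      simpa [mul_assoc] using this
    have h2 : g = (a : G)⁻¹ * (b : G)⁻¹ := by
      have : (a : G)⁻¹ * (a * g * b) * (b : G)⁻¹ = (a : G)⁻¹ * 1 * (b : G)⁻¹ := by rw [h1]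
      simpa [mul_assoc] using this
    rw [h2]; exact A.mul_mem (A.inv_mem a.2) (A.inv_mem b.2)
  have hbot : A = ⊥ := by
    rw [eq_bot_iff]
    intro z hz
    by_contra h
    exact hcon z hz h (A.mul_mem (A.mul_mem (A.inv_mem hg) hz) hg)
  apply hA
  apply Subgroup.eq_top_of_card_eq
  apply le_antisymm (Subgroup.card_le_card_group A)
  have : Nat.card A = 1 := by rw [hbot]; simp
  rw [this] at hle ⊢; simpa using hle

theorem exists_normal_p_aux {G : Type u} [Group G] [Finite G] (A : Subgroup G) (hcyc : IsCyclic A)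
    (hA : A ≠ ⊤) (hle : Nat.card G ≤ Nat.card A * Nat.card A) :
    ∃ p : ℕ, p.Prime ∧ ∃ P : Subgroup G, P.Normal ∧ IsPGroup p P ∧ P ≠ ⊥ := by
  obtain ⟨g, -, hg⟩ := Set.Finite.exists_minimalFor
    (fun g : G => {z : G | z ∈ A ∧ g⁻¹ * z * g ∈ A}) Set.univ (Set.toFinite _) ⟨1, trivial⟩
  have hcomm : ∀ a ∈ A, ∀ b ∈ A, a * b = b * a := by
    intro a ha b hb
    have := hcyc.isMulCommutative.is_comm.comm ⟨a, ha⟩ ⟨b, hb⟩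
    exact congrArg Subtype.val this
  set B := A.map (MulAut.conj g).toMonoidHom with hB
  have hmemB : ∀ z, z ∈ B ↔ g⁻¹ * z * g ∈ A := by
    intro z
    constructor
    · rintro ⟨a, ha, rfl⟩
      simpa [mul_assoc] using ha
    · intro h
      exact ⟨_, h, by simp [mul_assoc]⟩
  have hcommB : ∀ a ∈ B, ∀ b ∈ B, a * b = b * a := by
    rintro _ ⟨a, ha, rfl⟩ _ ⟨b, hb, rfl⟩
    rw [← map_mul, ← map_mul, hcomm a ha b hb]
  obtain ⟨z, hzA, hz1, hzg⟩ := conj_inf_aux A hA hle g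
  have hne : Nat.card (A ⊓ B : Subgroup G) ≠ 1 := by
    intro h
    have h1 := Subgroup.card_eq_one.1 h
    have : z ∈ A ⊓ B := ⟨hzA, (hmemB z).2 hzg⟩
    rw [h1] at this
    exact hz1 this
  obtain ⟨p, hp, hpd⟩ := Nat.exists_prime_and_dvd hne
  have : Fact p.Prime := ⟨hp⟩
  obtain ⟨x, hx⟩ := exists_prime_orderOf_dvd_card' p hpd
  have hxp : (x : G) ^ p = 1 := by
    have := pow_orderOf_eq_one x
    rw [hx] at this
    exact congrArg Subtype.val this
  obtain ⟨P, h1, h2, h3⟩ := zenkov_aux p (Nat.card G) G rfl A B hcomm hcommB (by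
    intro h hh w hwA hwB
    have hm := @hg (h * g) trivial (by
      rintro y ⟨hyA, hyg⟩
      refine ⟨hyA, (hmemB y).1 (hh y hyA ((hmemB _).2 ?_))⟩
      simpa [mul_assoc] using hyg)
    have := (hm ⟨hwA, (hmemB w).1 hwB⟩).2
    rw [hmemB]
    simpa [mul_assoc] using this) x x.2.1 x.2.2 hxp
  refine ⟨p, hp, P, h1, h2, ?_⟩
  rintro rfl
  have hx1 : x = 1 := Subtype.ext h3
  rw [hx1, orderOf_one] at hx
  exact hp.one_lt.ne hx

theorem exists_min_aux {G : Type u} [Group G] [Finite G] (p : ℕ) (hp : p.Prime) (P : Subgroup G)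
    (hPn : P.Normal) (hP : IsPGroup p P) (hP1 : P ≠ ⊥) :
    ∃ E : Subgroup G, E.Normal ∧ E ≠ ⊥ ∧ (∀ a ∈ E, ∀ b ∈ E, a * b = b * a) ∧
      (∀ e ∈ E, e ^ p = 1) ∧ ∀ N : Subgroup G, N.Normal → N ≤ E → N ≠ ⊥ → N = E := by
  have : Fact p.Prime := ⟨hp⟩
  have : Nontrivial P := (Subgroup.nontrivial_iff_ne_bot P).2 hP1
  set E0 := (Subgroup.center P).map P.subtype with hE0
  have hE0n : E0.Normal := inferInstance
  have hE01 : E0 ≠ ⊥ := by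
    intro h
    rw [hE0, Subgroup.map_eq_bot_iff_of_injective _ P.subtype_injective] at h
    exact hP.bot_lt_center.ne' h
  obtain ⟨E, ⟨hEn, hE1, hEE0⟩, hmin⟩ := Set.Finite.exists_minimal
    (s := {E : Subgroup G | E.Normal ∧ E ≠ ⊥ ∧ E ≤ E0}) (Set.toFinite _) ⟨E0, hE0n, hE01, le_rfl⟩
  have hmin' : ∀ N : Subgroup G, N.Normal → N ≤ E → N ≠ ⊥ → N = E := fun N h1 h2 h3 =>
    le_antisymm h2 (hmin ⟨h1, h3, h2.trans hEE0⟩ h2)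
  have hcomm : ∀ a ∈ E, ∀ b ∈ E, a * b = b * a := by
    intro a ha b hb
    obtain ⟨a', ha', rfl⟩ := hEE0 ha
    obtain ⟨b', hb', rfl⟩ := hEE0 hb
    rw [← map_mul, ← map_mul]
    congr 1
    exact Subgroup.mem_center_iff.1 hb' a'
  have hEP : IsPGroup p E := hP.to_le (hEE0.trans (by rintro _ ⟨x, -, rfl⟩; exact x.2))
  refine ⟨E, hEn, hE1, hcomm, ?_, hmin'⟩
  let T : Subgroup G :=
    { carrier := {e | e ∈ E ∧ e ^ p = 1}
      one_mem' := ⟨E.one_mem, one_pow p⟩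
      mul_mem' := by
        rintro a b ⟨ha, ha'⟩ ⟨hb, hb'⟩
        refine ⟨E.mul_mem ha hb, ?_⟩
        rw [Commute.mul_pow (hcomm a ha b hb), ha', hb', one_mul]
      inv_mem' := by
        rintro a ⟨ha, ha'⟩
        refine ⟨E.inv_mem ha, ?_⟩
        rw [inv_pow, ha', inv_one] }
  have hTn : T.Normal := by
    refine ⟨?_⟩
    rintro a ⟨ha, ha'⟩ g
    refine ⟨hEn.conj_mem a ha g, ?_⟩
    rw [conj_pow, ha']; simp
  have hT1 : T ≠ ⊥ := by
    obtain ⟨k, hk⟩ := IsPGroup.iff_card.1 hEP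
    have hk0 : k ≠ 0 := by
      rintro rfl
      exact hE1 (Subgroup.card_eq_one.1 (by simpa using hk))
    obtain ⟨x, hx⟩ := exists_prime_orderOf_dvd_card' (G := E) p (by
      rw [hk]; exact dvd_pow_self p hk0)
    intro h
    have hxp : (x : G) ^ p = 1 := by
      have := pow_orderOf_eq_one x
      rw [hx] at this
      exact congrArg Subtype.val this
    have hxT : (x : G) ∈ T := ⟨x.2, hxp⟩
    rw [h] at hxT
    have hx1 : x = 1 := Subtype.ext hxT
    rw [hx1, orderOf_one] at hx
    exact hp.one_lt.ne hx
  have hTE := hmin' T hTn (fun e he => he.1) hT1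
  intro e he
  rw [← hTE] at he
  exact he.2

theorem quot_aux {G : Type u} [Group G] [Finite G] (A E : Subgroup G) (hcyc : IsCyclic A)
    (hEn : E.Normal) (hAE : A ⊔ E ≠ ⊤)
    (HL : ∀ A' : Subgroup (G ⧸ (A ⊔ E).normalCore), IsCyclic A' → A' ≠ ⊤ →
      (∀ N : Subgroup (G ⧸ (A ⊔ E).normalCore), N.Normal → N ≤ A' → N = ⊥) →
      Nat.card A' * Nat.card A' < Nat.card (G ⧸ (A ⊔ E).normalCore)) :
    (A ⊔ E).normalCore.relIndex A * (A ⊔ E).normalCore.relIndex A < (A ⊔ E).normalCore.index := by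
  set K := (A ⊔ E).normalCore with hK
  have hs := QuotientGroup.mk'_surjective K
  have hKle : K ≤ A ⊔ E := Subgroup.normalCore_le _
  have hcard : Nat.card (A.map (QuotientGroup.mk' K)) = K.relIndex A := by
    rw [← Subgroup.relIndex_ker, QuotientGroup.ker_mk']
  have hcm : (A.map (QuotientGroup.mk' K)).comap (QuotientGroup.mk' K) ≤ A ⊔ E := by
    rw [Subgroup.comap_map_eq, QuotientGroup.ker_mk']
    exact sup_le le_sup_left hKle
  have := HL (A.map (QuotientGroup.mk' K))
    (isCyclic_of_surjective _ ((QuotientGroup.mk' K).subgroupMap_surjective A))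
    (by
      intro h
      rw [h, Subgroup.comap_top] at hcm
      exact hAE (top_le_iff.1 hcm))
    (by
      intro N hN hNA
      have h1 : N.comap (QuotientGroup.mk' K) ≤ K := by
        have hn : (N.comap (QuotientGroup.mk' K)).Normal := hN.comap _
        exact Subgroup.normal_le_normalCore.2 ((Subgroup.comap_mono hNA).trans hcm)
      rw [← Subgroup.map_comap_eq_self_of_surjective hs N, eq_bot_iff]
      refine (Subgroup.map_mono h1).trans ?_
      rw [QuotientGroup.map_mk'_self])
  rwa [hcard, ← Subgroup.index_eq_card] at this

/-- The theorem of Lucchini on core-free cyclic subgroups. -/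
theorem lucchini_aux (n : ℕ) : ∀ (G : Type u) [Group G] [Finite G], Nat.card G = n →
    ∀ A : Subgroup G, IsCyclic A → A ≠ ⊤ → (∀ N : Subgroup G, N.Normal → N ≤ A → N = ⊥) →
    Nat.card A * Nat.card A < Nat.card G := by
  induction n using Nat.strong_induction_on with
  | _ n ih =>
  intro G _ _ hn A hcyc hA hcf
  by_contra hcon
  rw [not_lt] at hcon
  have hcomm : ∀ a ∈ A, ∀ b ∈ A, a * b = b * a := by
    intro a ha b hb
    have := hcyc.isMulCommutative.is_comm.comm ⟨a, ha⟩ ⟨b, hb⟩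
    exact congrArg Subtype.val this
  obtain ⟨p, hp, P, hPn, hPp, hP1⟩ := exists_normal_p_aux A hcyc hA hcon
  have : Fact p.Prime := ⟨hp⟩
  obtain ⟨E, hEn, hE1, hEcomm, hEp, hEmin⟩ := exists_min_aux p hp P hPn hPp hP1
  have hEA : ¬ E ≤ A := fun h => hE1 (hcf E hEn h)
  by_cases hAE : A ⊔ E = ⊤
  · -- G = AE
    have hnorm : ∀ N : Subgroup G, (∀ a ∈ A, ∀ z ∈ N, a * z * a⁻¹ ∈ N) →
        (∀ e ∈ E, ∀ z ∈ N, e * z * e⁻¹ ∈ N) → N.Normal := by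
      intro N h1 h2
      refine ⟨fun z hz g => ?_⟩
      have hg : g ∈ A ⊔ E := by rw [hAE]; trivial
      obtain ⟨a, ha, e, he, rfl⟩ := Subgroup.mem_sup_of_normal_right.1 hg
      have := h1 a ha _ (h2 e he z hz)
      simpa [mul_assoc] using this
    have hcent : A ⊓ Subgroup.centralizer (E : Set G) = ⊥ := by
      refine hcf _ (hnorm _ ?_ ?_) inf_le_left
      · rintro a ha z ⟨hz, hzE⟩
        rw [hcomm a ha z hz, mul_assoc]; simpa using ⟨hz, hzE⟩
      · rintro e he z ⟨hz, hzE⟩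
        rw [Subgroup.mem_centralizer_iff.1 hzE e he, mul_assoc]; simpa using ⟨hz, hzE⟩
    have hdisj : A ⊓ E = ⊥ := by
      rw [eq_bot_iff, ← hcent]
      refine inf_le_inf_left A ?_
      intro e he
      rw [Subgroup.mem_centralizer_iff]
      intro f hf
      exact hEcomm f hf e he
    have hlt : Nat.card A < Nat.card E := by
      obtain ⟨e, he, he1⟩ := (Subgroup.ne_bot_iff_exists_ne_one.1 hE1 : ∃ a : E, a ≠ 1) |>.elim
        (fun a ha => (⟨a, a.2, fun h => ha (Subtype.ext h)⟩ : ∃ e ∈ E, e ≠ (1 : G)))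
      let f : A → E := fun a => ⟨a * e * (a : G)⁻¹, hEn.conj_mem e he a⟩
      have hfix : ∀ a ∈ A, a * e = e * a → a = 1 := by
        intro a ha hae
        have h1 : E ⊓ Subgroup.centralizer {a} = E := by
          refine hEmin _ (hnorm _ ?_ ?_) inf_le_left ?_
          · rintro b hb z ⟨hz, hza⟩
            refine ⟨hEn.conj_mem z hz b, ?_⟩
            replace hza := Subgroup.mem_centralizer_singleton_iff.1 hza
            refine Subgroup.mem_centralizer_singleton_iff.2 ?_
            have h2 := hcomm a ha b hb
            have h3 := hcomm a ha _ (A.inv_mem hb)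
            calc b * z * b⁻¹ * a = b * z * (b⁻¹ * a) := by group
              _ = b * (z * a) * b⁻¹ := by rw [← h3]; group
              _ = (b * a) * z * b⁻¹ := by rw [hza]; group
              _ = a * (b * z * b⁻¹) := by rw [← h2]; group
          · rintro f hf z ⟨hz, hza⟩
            rw [hEcomm f hf z hz, mul_assoc]; simpa using ⟨hz, hza⟩
          · intro h
            have h2 : e ∈ E ⊓ Subgroup.centralizer {a} := by
              refine ⟨he, ?_⟩
              refine Subgroup.mem_centralizer_singleton_iff.2 ?_
              exact hae.symm
            rw [h] at h2
            exact he1 h2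
        have h2 : a ∈ A ⊓ Subgroup.centralizer (E : Set G) := by
          refine ⟨ha, ?_⟩
          refine Subgroup.mem_centralizer_iff.2 ?_
          intro z hz
          rw [← h1] at hz
          exact Subgroup.mem_centralizer_singleton_iff.1 hz.2
        rw [hcent] at h2
        exact h2
      have hf : Function.Injective f := by
        intro a b hab
        have h1 : (a : G) * e * (a : G)⁻¹ = b * e * (b : G)⁻¹ := congrArg Subtype.val hab
        have h2 := hfix ((b : G)⁻¹ * a) (A.mul_mem (A.inv_mem b.2) a.2) (by
          have : (b : G)⁻¹ * (a * e * (a : G)⁻¹) * a = (b : G)⁻¹ * (b * e * (b : G)⁻¹) * a := by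
            rw [h1]
          simpa [mul_assoc] using this)
        exact Subtype.ext (inv_mul_eq_one.1 h2).symm
      refine lt_of_le_of_ne (Nat.card_le_card_of_injective f hf) ?_
      intro hc
      obtain ⟨a, ha⟩ := ((Nat.bijective_iff_injective_and_card f).2 ⟨hf, hc⟩).2 1
      have h1 : (a : G) * e * (a : G)⁻¹ = 1 := congrArg Subtype.val ha
      apply he1
      simpa using h1
    have h1 := card_mul_le_aux A E hdisj
    have h2 : Nat.card A * Nat.card A < Nat.card A * Nat.card E :=
      Nat.mul_lt_mul_of_pos_left hlt Nat.card_pos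
    omega
  · set M := (A ⊔ E).normalCore with hM
    have hMle : M ≤ A ⊔ E := Subgroup.normalCore_le _
    have hEM : E ≤ M := Subgroup.normal_le_normalCore.2 le_sup_right
    have hMn : M.Normal := inferInstance
    have hMlt : Nat.card M < n := by
      rw [← hn]
      refine lt_of_le_of_ne (Subgroup.card_le_card_group M) ?_
      intro h
      exact hAE (top_le_iff.1 ((Subgroup.eq_top_of_card_eq _ h) ▸ hMle))
    have hcardM := Subgroup.card_mul_index M
    have hM1 : 1 < Nat.card M := by
      have h1 : 1 < Nat.card E := by
        have : Nat.card E ≠ 1 := fun h => hE1 (Subgroup.card_eq_one.1 h)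
        have := Nat.card_pos (α := E)
        omega
      exact h1.trans_le (Subgroup.card_le_of_le hEM)
    have hr := quot_aux A E hcyc hEn hAE (by
      apply ih _ _ _ rfl
      rw [← Subgroup.index_eq_card, ← hn, ← hcardM]
      have : 0 < M.index := Nat.pos_of_ne_zero Subgroup.index_ne_zero_of_finite
      exact lt_mul_of_one_lt_left this hM1)
    rw [← hM] at hr
    -- `B = A ∩ M`
    set B := A ⊓ M with hB
    have hAB : Nat.card A = Nat.card B * M.relIndex A := by
      rw [← Subgroup.inf_relIndex_left, ← hB, Subgroup.relIndex, ← Subgroup.card_mul_index (B.subgroupOf A),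
        Nat.card_congr (Subgroup.subgroupOfEquivOfLe (inf_le_left : B ≤ A)).toEquiv]
    have hBM : Nat.card M < Nat.card B * Nat.card B := by
      rw [hAB, ← hcardM] at hcon
      set r := M.relIndex A
      by_contra h
      rw [not_lt] at h
      have h1 : Nat.card B * r * (Nat.card B * r) ≤ Nat.card M * (r * r) := by
        calc _ = (Nat.card B * Nat.card B) * (r * r) := by ring
          _ ≤ _ := Nat.mul_le_mul_right _ h
      have h2 : Nat.card M * (r * r) < Nat.card M * M.index :=
        Nat.mul_lt_mul_of_pos_left hr Nat.card_pos
      omega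
    have hMmem : ∀ m ∈ M, ∃ b ∈ B, ∃ e ∈ E, b * e = m := by
      intro m hm
      obtain ⟨a, ha, e, he, rfl⟩ := Subgroup.mem_sup_of_normal_right.1 (hMle hm)
      refine ⟨a, ⟨ha, ?_⟩, e, he, rfl⟩
      have := M.mul_mem hm (M.inv_mem (hEM he))
      simpa using this
    have hBA : B ≤ A := inf_le_left
    have hBM' : B ≤ M := inf_le_right
    have hBcyc : IsCyclic B := isCyclic_of_injective _ (Subgroup.inclusion_injective hBA)
    -- `D = Z(M)`
    set D := M ⊓ Subgroup.centralizer (M : Set G) with hD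
    have hDn : D.Normal := inferInstance
    by_cases hDE : D ⊓ E = ⊥
    · have h1 := inf_triv_aux A E M D hcyc hMle hDE hcf
      have hBE : ∀ b ∈ B, (∀ e ∈ E, e * b = b * e) → b = 1 := by
        intro b hb hbe
        have h2 : b ∈ A ⊓ D ⊓ M := by
          refine ⟨⟨hBA hb, hBM' hb, ?_⟩, hBM' hb⟩
          refine Subgroup.mem_centralizer_iff.2 ?_
          intro m hm
          obtain ⟨c, hc, e, he, rfl⟩ := hMmem m hm
          rw [mul_assoc, hbe e he, ← mul_assoc, hcomm c (hBA hc) b (hBA hb), mul_assoc]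
        rw [h1] at h2
        exact h2
      have h2 := ih _ hMlt M rfl (B.subgroupOf M)
        (isCyclic_of_injective (Subgroup.subgroupOfEquivOfLe hBM').toMonoidHom
          (Subgroup.subgroupOfEquivOfLe hBM').injective)
        (by
          rw [Ne, Subgroup.subgroupOf_eq_top]
          exact fun h => hEA (hEM.trans (h.trans hBA)))
        (by
          intro N hN hNB
          have hdis : Disjoint N (E.subgroupOf M) := by
            rw [Subgroup.disjoint_def]
            intro x hx hxE
            have h3 : (x : G) ∈ B := hNB hx
            exact Subtype.ext (hBE x h3 fun e he => hEcomm e he x hxE)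
          rw [eq_bot_iff]
          intro x hx
          have h3 : (x : G) ∈ B := hNB hx
          refine Subtype.ext (hBE x h3 fun e he => ?_)
          have h4 := Subgroup.commute_of_normal_of_disjoint _ _ hN inferInstance hdis x
            ⟨e, hEM he⟩ hx he
          exact (congrArg Subtype.val h4).symm)
      rw [Nat.card_congr (Subgroup.subgroupOfEquivOfLe hBM').toEquiv] at h2
      omega
    · have hED : E ≤ D := by
        rw [← hEmin (D ⊓ E) inferInstance inf_le_right hDE]
        exact inf_le_left
      have hEcent : ∀ e ∈ E, ∀ m ∈ M, m * e = e * m := fun e he m hm =>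
        Subgroup.mem_centralizer_iff.1 (hED he).2 m hm
      have hMcomm : ∀ m ∈ M, ∀ k ∈ M, m * k = k * m := by
        intro m hm k hk
        obtain ⟨b, hb, e, he, rfl⟩ := hMmem m hm
        rw [mul_assoc, ← hEcent e he k hk, ← mul_assoc]
        obtain ⟨c, hc, f, hf, rfl⟩ := hMmem k hk
        rw [← mul_assoc, hcomm b (hBA hb) c (hBA hc), mul_assoc c b f, hEcent f hf b (hBM' hb)]
        simp only [mul_assoc]
      -- `p`-th powers of `M`
      have hMp : ∀ m ∈ M, m ^ p = 1 := by
        let T : Subgroup G :=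
          { carrier := {z | ∃ m ∈ M, z = m ^ p}
            one_mem' := ⟨1, M.one_mem, (one_pow p).symm⟩
            mul_mem' := by
              rintro _ _ ⟨a, ha, rfl⟩ ⟨b, hb, rfl⟩
              exact ⟨a * b, M.mul_mem ha hb, (Commute.mul_pow (hMcomm a ha b hb) p).symm⟩
            inv_mem' := by
              rintro _ ⟨a, ha, rfl⟩
              exact ⟨a⁻¹, M.inv_mem ha, (inv_pow a p).symm⟩ }
        have hT : T = ⊥ := by
          apply hcf
          · refine ⟨?_⟩
            rintro _ ⟨m, hm, rfl⟩ g
            exact ⟨g * m * g⁻¹, hMn.conj_mem m hm g, conj_pow.symm⟩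
          · rintro _ ⟨m, hm, rfl⟩
            obtain ⟨b, hb, e, he, rfl⟩ := hMmem m hm
            rw [Commute.mul_pow (hMcomm b (hBM' hb) e (hEM he)), hEp e he, mul_one]
            exact A.pow_mem (hBA hb) p
        intro m hm
        have : m ^ p ∈ T := ⟨m, hm, rfl⟩
        rw [hT] at this
        exact this
      have hBp : Nat.card B ∣ p := by
        obtain ⟨b, hb⟩ := hBcyc.exists_generator
        rw [← orderOf_eq_card_of_forall_mem_zpowers hb]
        apply orderOf_dvd_of_pow_eq_one
        exact Subtype.ext (hMp b (hBM' b.2))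
      have hMpg : IsPGroup p M := fun m => ⟨1, Subtype.ext (by
        rw [pow_one]; exact hMp m m.2)⟩
      obtain ⟨k, hk⟩ := IsPGroup.iff_card.1 hMpg
      rcases (Nat.dvd_prime hp).1 hBp with h | h
      · rw [h] at hBM; omega
      · rw [h, hk, ← pow_two] at hBM
        have hk2 := (Nat.pow_lt_pow_iff_right hp.one_lt).1 hBM
        have hle : Nat.card M ≤ Nat.card B := by
          rw [hk, h]
          calc p ^ k ≤ p ^ 1 := Nat.pow_le_pow_right hp.pos (by omega)
            _ = p := pow_one p
        have hBeq : B = M := Subgroup.eq_of_le_of_card_ge hBM' hle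
        exact hEA (hEM.trans (hBeq ▸ hBA))

/-- Let `G = BY` with `B` monolithic with monolith `A`, `Y` cyclic and
core-free, and `B` not core-free in `G`. With `Z = Y ⊓ C_G(A)`, then `A ⊴ G` and
either `B = A` and `Z = 1`, or `|Z| ⬝ |A| < |B|`. -/
theorem stmt_4 {G : Type*} [Group G] [Finite G] (B Y A : Subgroup G)
    (hfact : ∀ g : G, ∃ b ∈ B, ∃ y ∈ Y, g = b * y)
    (hYcyc : IsCyclic ↥Y)
    (hYcorefree : ∀ N : Subgroup G, N.Normal → N ≤ Y → N = ⊥)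
    (hAB : A ≤ B) (hAne : A ≠ ⊥)
    (hAnormB : ∀ b ∈ B, ∀ a ∈ A, b * a * b⁻¹ ∈ A)
    (hAmin : ∀ N : Subgroup G, N ≤ B → (∀ b ∈ B, ∀ n ∈ N, b * n * b⁻¹ ∈ N) →
      N ≠ ⊥ → A ≤ N)
    (hAnonab : ∃ a ∈ A, ∃ a' ∈ A, a * a' ≠ a' * a)
    (hBnotcorefree : ∃ N : Subgroup G, N.Normal ∧ N ≤ B ∧ N ≠ ⊥) :
    A.Normal ∧
      ((B = A ∧ Y ⊓ Subgroup.centralizer (A : Set G) = ⊥) ∨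
        Nat.card ↥(Y ⊓ Subgroup.centralizer (A : Set G)) * Nat.card A < Nat.card B) := by
  have hcentB : ∀ c ∈ B, (∀ a ∈ A, a * c = c * a) → c = 1 := by
    intro c hc hca
    by_contra hc1
    have h1 := hAmin (B ⊓ Subgroup.centralizer (A : Set G)) inf_le_left (by
      rintro b hb z ⟨hz, hzA⟩
      refine ⟨B.mul_mem (B.mul_mem hb hz) (B.inv_mem hb), ?_⟩
      refine Subgroup.mem_centralizer_iff.2 ?_
      intro a ha
      have h2 := Subgroup.mem_centralizer_iff.1 hzA _ (hAnormB _ (B.inv_mem hb) a ha)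
      have h3 : b * (b⁻¹ * a * b⁻¹⁻¹ * z) * b⁻¹ = b * (z * (b⁻¹ * a * b⁻¹⁻¹)) * b⁻¹ := by rw [h2]
      simpa [mul_assoc] using h3) (by
      intro h
      have h2 : c ∈ B ⊓ Subgroup.centralizer (A : Set G) :=
        ⟨hc, Subgroup.mem_centralizer_iff.2 hca⟩
      rw [h] at h2
      exact hc1 h2)
    obtain ⟨a, ha, b, hb, hab⟩ := hAnonab
    exact hab (Subgroup.mem_centralizer_iff.1 (h1 hb).2 a ha)
  have hAn : A.Normal := by
    obtain ⟨N, hN, hNB, hN1⟩ := hBnotcorefree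
    have hAN : A ≤ N := hAmin N hNB (fun b _ n hn => hN.conj_mem n hn b) hN1
    obtain ⟨L, ⟨hLN, hLn, hL1⟩, hLmin⟩ := Set.Finite.exists_minimal
      (s := {L : Subgroup G | L ≤ N ∧ (∀ n ∈ N, ∀ l ∈ L, n * l * n⁻¹ ∈ L) ∧ L ≠ ⊥})
      (Set.toFinite _) ⟨A, hAN, fun n hn a ha => hAnormB n (hNB hn) a ha, hAne⟩
    have hLA : L ≤ A.normalCore := by
      intro l hl g
      -- `L ⊓ A^(g⁻¹)`
      set V := A.comap (MulAut.conj g).toMonoidHom with hV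
      have hmem : ∀ z, z ∈ V ↔ g * z * g⁻¹ ∈ A := fun z => Iff.rfl
      have hVn : ∀ n ∈ N, ∀ v ∈ V, n * v * n⁻¹ ∈ V := by
        intro n hn v hv
        rw [hmem] at *
        have := hAnormB _ (hNB (hN.conj_mem n hn g)) _ hv
        simpa [mul_assoc] using this
      have hVN : V ≤ N := by
        intro v hv
        have := hN.conj_mem _ (hAN ((hmem v).1 hv)) g⁻¹
        simpa [mul_assoc] using this
      have hne : L ⊓ V ≠ ⊥ := by
        intro hbot
        have hcomm : ∀ l ∈ L, ∀ v ∈ V, v * l = l * v := by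
          intro l hl v hv
          have h1 : v * l * v⁻¹ * l⁻¹ ∈ L ⊓ V := by
            refine ⟨L.mul_mem (hLn v (hVN hv) l hl) (L.inv_mem hl), ?_⟩
            have := V.mul_mem hv (hVn l (hLN hl) _ (V.inv_mem hv))
            simpa [mul_assoc] using this
          rw [hbot, Subgroup.mem_bot, mul_inv_eq_one, mul_inv_eq_iff_eq_mul] at h1
          exact h1
        apply hL1
        rw [eq_bot_iff]
        intro l hl
        have h1 := hcentB (g * l * g⁻¹) (hNB (hN.conj_mem l (hLN hl) g)) (by
          intro a ha
          have h2 := hcomm l hl (g⁻¹ * a * g) ((hmem _).2 (by simpa [mul_assoc] using ha))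
          have h3 : g * (g⁻¹ * a * g * l) * g⁻¹ = g * (l * (g⁻¹ * a * g)) * g⁻¹ := by rw [h2]
          simpa [mul_assoc] using h3)
        simpa using h1
      have hle := hLmin ⟨inf_le_left.trans hLN, fun n hn z hz =>
        ⟨hLn n hn z hz.1, hVn n hn z hz.2⟩, hne⟩ inf_le_left
      exact (hle hl).2
    have hcore : A ≤ A.normalCore := by
      refine hAmin _ ((Subgroup.normalCore_le A).trans hAB)
        (fun b _ n hn => (inferInstance : A.normalCore.Normal).conj_mem n hn b) ?_
      intro h
      exact hL1 (le_bot_iff.1 (h ▸ hLA))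
    rw [le_antisymm hcore (Subgroup.normalCore_le A)]
    infer_instance
  refine ⟨hAn, ?_⟩
  set C := Subgroup.centralizer (A : Set G) with hC
  have hCn : C.Normal := inferInstance
  have hCA : C ⊓ A = ⊥ := by
    rw [eq_bot_iff]
    rintro c ⟨hc, hcA⟩
    exact hcentB c (hAB hcA) (Subgroup.mem_centralizer_iff.1 hc)
  have htriv := inf_triv_aux Y A (Y ⊔ A).normalCore C hYcyc (Subgroup.normalCore_le _) hCA
    hYcorefree
  have hcardB : Nat.card B = Nat.card A * A.relIndex B := by
    rw [Subgroup.relIndex, ← Subgroup.card_mul_index (A.subgroupOf B),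
      Nat.card_congr (Subgroup.subgroupOfEquivOfLe hAB).toEquiv]
  by_cases hYA : Y ⊔ A = ⊤
  · have hZ : Y ⊓ C = ⊥ := by
      have h1 : (Y ⊔ A).normalCore = ⊤ :=
        top_le_iff.1 (Subgroup.normal_le_normalCore.2 hYA.ge)
      rwa [h1, inf_top_eq] at htriv
    by_cases hBA : B = A
    · exact Or.inl ⟨hBA, hZ⟩
    · right
      rw [hZ, Subgroup.card_bot, one_mul]
      refine lt_of_le_of_ne (Subgroup.card_le_of_le hAB) fun h => hBA ?_
      exact (Subgroup.eq_of_le_of_card_ge hAB h.ge).symm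
  · right
    have hr := quot_aux Y A hYcyc hAn hYA (lucchini_aux _ _ rfl)
    have hAK : A ≤ (Y ⊔ A).normalCore := Subgroup.normal_le_normalCore.2 le_sup_right
    set K := (Y ⊔ A).normalCore with hK
    have hKle : K ≤ Y ⊔ A := Subgroup.normalCore_le _
    have hsup : Y ⊔ K = Y ⊔ A :=
      le_antisymm (sup_le le_sup_left hKle) (sup_le_sup_left hAK Y)
    have h1 : K.relIndex Y * (Y ⊔ A).index = K.index := by
      rw [← Subgroup.relIndex_sup_right, hsup]
      exact Subgroup.relIndex_mul_index hKle
    have h2 : Nat.card (Y ⊓ C : Subgroup G) ≤ K.relIndex Y := by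
      have h3 : K.relIndex (Y ⊓ C) = Nat.card (Y ⊓ C : Subgroup G) := by
        rw [← Subgroup.inf_relIndex_left, htriv, Subgroup.relIndex_bot_left]
      rw [← h3]
      exact Subgroup.relIndex_le_of_le_right inf_le_left Subgroup.index_ne_zero_of_finite
    have h4 : K.relIndex Y < (Y ⊔ A).index := by
      rw [← h1] at hr
      exact lt_of_mul_lt_mul_left hr (Nat.zero_le _)
    have h5 : (Y ⊔ A).index ≤ A.relIndex B := by
      have h6 : (Y ⊔ A).index ≤ (Y ⊔ A).relIndex B := by
        rw [Subgroup.index_eq_card, Subgroup.relIndex, Subgroup.index_eq_card]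
        let f : B ⧸ (Y ⊔ A).subgroupOf B → G ⧸ (Y ⊔ A) :=
          Quotient.map' (fun b : B => (b : G)) (by
            intro b c hbc
            rw [QuotientGroup.leftRel_apply] at *
            exact hbc)
        refine Nat.card_le_card_of_surjective f ?_
        intro q
        obtain ⟨g, rfl⟩ := QuotientGroup.mk_surjective q
        obtain ⟨b, hb, y, hy, rfl⟩ := hfact g
        refine ⟨QuotientGroup.mk ⟨b, hb⟩, ?_⟩
        show (QuotientGroup.mk b : G ⧸ (Y ⊔ A)) = QuotientGroup.mk (b * y)
        rw [QuotientGroup.eq]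
        simpa using Subgroup.mem_sup_left hy
      exact h6.trans (Subgroup.relIndex_le_of_le_left le_sup_right
        Subgroup.index_ne_zero_of_finite)
    rw [hcardB, mul_comm]
    exact Nat.mul_lt_mul_of_pos_left (by omega) Nat.card_pos
end

section
/- Let G be a finite group with core-free subgroups B and Y such that G = BY (every element of G is a product b*y with b ∈ B, y ∈ Y), where B is monolithic with monolith A (regarded as a subgroup of G) and Y is cyclic. Then G has a unique minimal normal subgroup N, and A ≤ N; that is, there is a nontrivial normal subgroup N of G with A ≤ N such that N is contained in every nontrivial normal subgroup of G. -/
section Helpers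
open scoped commutatorElement

lemma aux_perm3 (X : Type*) [Finite X] (h : Nat.card X = 3) : Group.IsSolvable (Equiv.Perm X) := by
  classical
  letI := Fintype.ofFinite X
  have : Nontrivial X := by
    rw [← Finite.one_lt_card_iff_nontrivial]; omega
  have hc : Nat.card (alternatingGroup X) = 3 := by
    have := two_mul_card_alternatingGroup (α := X)
    rw [Fintype.card_perm, ← Nat.card_eq_fintype_card, ← Nat.card_eq_fintype_card, h] at this
    simp [Nat.factorial] at this
    simp
    omega
  have : Fact (Nat.Prime 3) := ⟨Nat.prime_three⟩
  have := isCyclic_of_prime_card hc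
  have : Group.IsSolvable (alternatingGroup X) :=
    Group.isSolvable_of_comm (fun a b => by
      letI := IsCyclic.commGroup (α := alternatingGroup X); exact mul_comm a b)
  exact Group.isSolvable_of_ker_le_range (alternatingGroup X).subtype (Equiv.Perm.sign (α := X)) (by
    rw [Subgroup.range_subtype]; exact le_refl _)

lemma aux_mulAut4 (M : Type*) [Group M] (h : Nat.card M = 4) : Group.IsSolvable (MulAut M) := by
  classical
  have : Finite M := Nat.finite_of_card_ne_zero (by omega)
  letI := Fintype.ofFinite M
  have h3 : Nat.card {m : M // m ≠ 1} = 3 := by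
    rw [Nat.card_eq_fintype_card] at h ⊢
    simp [Fintype.card_subtype_compl, h]
  have := aux_perm3 _ h3
  let f : MulAut M →* Equiv.Perm {m : M // m ≠ 1} :=
    { toFun := fun φ => φ.toEquiv.subtypeEquiv (fun a => by simp)
      map_one' := by ext; rfl
      map_mul' := by intros; ext; rfl }
  apply Group.isSolvable_of_isSolvable_injective (f := f)
  intro φ ψ hφ
  ext m
  by_cases hm : m = 1
  · simp [hm]
  · have := DFunLike.congr_fun hφ ⟨m, hm⟩
    exact congrArg Subtype.val this

lemma aux_mulAutPrime (M : Type*) [Group M] (h : (Nat.card M).Prime) : Group.IsSolvable (MulAut M) := by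
  have : Fact (Nat.card M).Prime := ⟨h⟩
  have := isCyclic_of_prime_card (α := M) rfl
  exact Group.isSolvable_of_isSolvable_injective (f := (IsCyclic.mulAutMulEquiv M).toMonoidHom)
    (IsCyclic.mulAutMulEquiv M).injective

lemma aux_ito (H : Type*) [Group H] (A B : Subgroup H) (hA : ∀ a ∈ A, ∀ b ∈ A, a * b = b * a)
    (hB : ∀ a ∈ B, ∀ b ∈ B, a * b = b * a) (hAB : ∀ g : H, ∃ a ∈ A, ∃ b ∈ B, g = a * b) :
    Group.IsSolvable H := by
  have hBA : ∀ g : H, ∃ b ∈ B, ∃ a ∈ A, g = b * a := by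
    intro g
    obtain ⟨a, ha, b, hb, h⟩ := hAB g⁻¹
    exact ⟨b⁻¹, B.inv_mem hb, a⁻¹, A.inv_mem ha, by rw [← mul_inv_rev, ← h, inv_inv]⟩
  have k1 : ∀ c ∈ A, ∀ b ∈ B, ∃ b1 ∈ B, ∀ a ∈ A, c * ⁅a, b⁆ * c⁻¹ = ⁅a, b1⁆ := by
    intro c hc b hb
    obtain ⟨b1, hb1, a1, ha1, h⟩ := hBA (c * b * c⁻¹)
    refine ⟨b1, hb1, fun a ha => ?_⟩
    have e1 : c * ⁅a, b⁆ * c⁻¹ = ⁅c * a * c⁻¹, c * b * c⁻¹⁆ := by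
      simp only [commutatorElement_def]; group
    have e2 : c * a * c⁻¹ = a := by rw [hA c hc a ha]; group
    rw [e1, e2, h]
    have e3 : a1 * a⁻¹ = a⁻¹ * a1 := hA _ ha1 _ (A.inv_mem ha)
    calc ⁅a, b1 * a1⁆ = a * b1 * (a1 * a⁻¹) * a1⁻¹ * b1⁻¹ := by
          simp only [commutatorElement_def]; group
      _ = ⁅a, b1⁆ := by rw [e3]; simp only [commutatorElement_def]; group
  have k2 : ∀ d ∈ B, ∀ a ∈ A, ∃ a2 ∈ A, ∀ b ∈ B, d * ⁅a, b⁆ * d⁻¹ = ⁅a2, b⁆ := by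
    intro d hd a ha
    obtain ⟨a2, ha2, b2, hb2, h⟩ := hAB (d * a * d⁻¹)
    refine ⟨a2, ha2, fun b hb => ?_⟩
    have e1 : d * ⁅a, b⁆ * d⁻¹ = ⁅d * a * d⁻¹, d * b * d⁻¹⁆ := by
      simp only [commutatorElement_def]; group
    have e2 : d * b * d⁻¹ = b := by rw [hB d hd b hb]; group
    rw [e1, e2, h]
    have e3 : b2 * b = b * b2 := hB _ hb2 _ hb
    calc ⁅a2 * b2, b⁆ = a2 * (b2 * b) * b2⁻¹ * a2⁻¹ * b⁻¹ := by
          simp only [commutatorElement_def]; group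
      _ = ⁅a2, b⁆ := by rw [e3]; simp only [commutatorElement_def]; group
  set S : Set H := {x | ∃ a ∈ A, ∃ b ∈ B, x = ⁅a, b⁆} with hS
  have hcomm : ∀ x ∈ S, ∀ y ∈ S, x * y = y * x := by
    rintro x ⟨c, hc, d, hd, rfl⟩ y ⟨a, ha, b, hb, rfl⟩
    have hc' := A.inv_mem hc
    have hd' := B.inv_mem hd
    obtain ⟨b1, hb1, h1⟩ := k1 c⁻¹ hc' b hb
    obtain ⟨a2, ha2, h2⟩ := k2 d⁻¹ hd' a ha
    have q1 : d⁻¹ * (c⁻¹ * ⁅a, b⁆ * c⁻¹⁻¹) * d⁻¹⁻¹ = ⁅a2, b1⁆ := by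
      rw [h1 a ha, h2 b1 hb1]
    have q2 : c⁻¹ * (d⁻¹ * ⁅a, b⁆ * d⁻¹⁻¹) * c⁻¹⁻¹ = ⁅a2, b1⁆ := by
      rw [h2 b hb, h1 a2 ha2]
    have q3 := q1.trans q2.symm
    generalize ⁅a, b⁆ = z at *
    have : c * d * (d⁻¹ * (c⁻¹ * z * c⁻¹⁻¹) * d⁻¹⁻¹) * (c⁻¹ * d⁻¹) =
      c * d * (c⁻¹ * (d⁻¹ * z * d⁻¹⁻¹) * c⁻¹⁻¹) * (c⁻¹ * d⁻¹) := by rw [q3]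
    simp only [commutatorElement_def]
    calc c * d * c⁻¹ * d⁻¹ * z = c * d * (c⁻¹ * (d⁻¹ * z * d⁻¹⁻¹) * c⁻¹⁻¹) * (c⁻¹ * d⁻¹) := by group
      _ = _ := by rw [← this]; group
  set N := Subgroup.closure S with hN
  have hNc : ∀ x ∈ N, ∀ y ∈ N, x * y = y * x := by
    intro x hx y hy
    have := Subgroup.isMulCommutative_closure (k := S) hcomm
    exact congrArg Subtype.val (mul_comm' (⟨x, hx⟩ : N) ⟨y, hy⟩)
  have hcl : ∀ g : H, (∀ x ∈ S, g * x * g⁻¹ ∈ S) → ∀ x ∈ N, g * x * g⁻¹ ∈ N := by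
    intro g hg x hx
    have : N ≤ N.comap (MulAut.conj g).toMonoidHom := by
      rw [hN, Subgroup.closure_le]
      intro x hx
      exact Subgroup.subset_closure (hg x hx)
    exact this hx
  have hNn : N.Normal := by
    constructor
    intro n hn g
    obtain ⟨a, ha, b, hb, rfl⟩ := hAB g
    have t1 := hcl b (by
      rintro _ ⟨a', ha', b', hb', rfl⟩
      obtain ⟨a2, ha2, h2⟩ := k2 b hb a' ha'
      exact ⟨a2, ha2, b', hb', h2 b' hb'⟩) n hn
    have t2 := hcl a (by
      rintro _ ⟨a', ha', b', hb', rfl⟩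
      obtain ⟨a2, ha2, h2⟩ := k1 a ha b' hb'
      exact ⟨a', ha', a2, ha2, h2 a' ha'⟩) _ t1
    convert t2 using 1
    group
  rw [Group.isSolvable_iff_subgroup_quotient N]
  constructor
  · exact Group.isSolvable_of_comm (fun a b => Subtype.ext (hNc a a.2 b b.2))
  · apply Group.isSolvable_of_comm
    have hq : ∀ a ∈ A, ∀ b ∈ B, (a : H ⧸ N) * b = b * a := by
      intro a ha b hb
      rw [← QuotientGroup.mk_mul, ← QuotientGroup.mk_mul, eq_comm, QuotientGroup.eq]
      have : ⁅a⁻¹, b⁻¹⁆ ∈ N := Subgroup.subset_closure ⟨_, A.inv_mem ha, _, B.inv_mem hb, rfl⟩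
      convert this using 1
      simp only [commutatorElement_def]; group
    intro x y
    obtain ⟨g, rfl⟩ := QuotientGroup.mk_surjective x
    obtain ⟨h, rfl⟩ := QuotientGroup.mk_surjective y
    obtain ⟨a, ha, b, hb, rfl⟩ := hAB g
    obtain ⟨a', ha', b', hb', rfl⟩ := hAB h
    have e1 : (a : H ⧸ N) * a' = a' * a := by
      rw [← QuotientGroup.mk_mul, hA a ha a' ha']; rfl
    have e2 : (b : H ⧸ N) * b' = b' * b := by
      rw [← QuotientGroup.mk_mul, hB b hb b' hb']; rfl
    have e3 := hq a ha b' hb'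
    have e4 := hq a' ha' b hb
    have e5 := hq a ha b hb
    change (a : H ⧸ N) * b * (a' * b') = a' * b' * (a * b)
    have c1 : Commute (a : H ⧸ N) (a' * b') := Commute.mul_right e1 e3
    have c2 : Commute (b : H ⧸ N) (a' * b') := Commute.mul_right e4.symm e2
    exact c1.mul_left c2

lemma aux_lin {p : ℕ} [Fact p.Prime] {V : Type*} [AddCommGroup V] [Module (ZMod p) V] [Finite V]
    (f : Module.End (ZMod p) V) (s r k : ℕ) (hf : f ^ p ^ s = 1) (hV : Nat.card V = p ^ k)
    (hk : k + 1 ≤ p ^ r) : ∑ i ∈ Finset.range (p ^ r), f ^ i = 0 := by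
  have hp := (Fact.out : p.Prime)
  have hfr : Module.finrank (ZMod p) V = k := by
    have := Module.natCard_eq_pow_finrank (K := ZMod p) (V := V)
    rw [hV, Nat.card_zmod] at this
    exact (Nat.pow_right_injective hp.two_le this).symm
  have poly : ∀ s, ((Polynomial.X : Polynomial (ZMod p)) - 1) ^ p ^ s = Polynomial.X ^ p ^ s - 1 := by
    intro s
    rw [sub_pow_char_pow, one_pow]
  have hnil : (f - 1) ^ p ^ s = 0 := by
    have := congrArg (Polynomial.aeval f) (poly s)
    simpa [hf] using this
  have hnk : (f - 1) ^ k = 0 := by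
    have h1 := IsNilpotent.charpoly_eq_X_pow_finrank (φ := f - 1) ⟨_, hnil⟩
    have h2 := LinearMap.aeval_self_charpoly (f - 1)
    rw [h1, hfr] at h2
    simpa using h2
  have hgeom : ∑ i ∈ Finset.range (p ^ r), (Polynomial.X : Polynomial (ZMod p)) ^ i
      = (Polynomial.X - 1) ^ (p ^ r - 1) := by
    have hne : (Polynomial.X - 1 : Polynomial (ZMod p)) ≠ 0 := Polynomial.X_sub_C_ne_zero 1
    apply mul_right_cancel₀ hne
    rw [geom_sum_mul, ← pow_succ, Nat.sub_add_cancel (by omega), poly]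
  have := congrArg (Polynomial.aeval f) hgeom
  simp at this
  rw [this]
  exact pow_eq_zero_of_le (by omega) hnk

lemma aux_add {p : ℕ} [Fact p.Prime] {V : Type*} [AddCommGroup V] [Module (ZMod p) V] [Finite V]
    (f : V →+ V) (s r k : ℕ) (hf : ∀ v, f^[p ^ s] v = v) (hV : Nat.card V = p ^ k)
    (hk : k + 1 ≤ p ^ r) (v : V) : ∑ i ∈ Finset.range (p ^ r), f^[i] v = 0 := by
  let g : Module.End (ZMod p) V := AddMonoidHom.toZModLinearMap p f
  have hg : ∀ (i : ℕ) (v : V), (g ^ i) v = f^[i] v := by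
    intro i v
    rw [Module.End.pow_apply]
    rfl
  have key := aux_lin g s r k (by
    refine LinearMap.ext fun x => ?_
    rw [hg, hf]; rfl) hV hk
  have := LinearMap.congr_fun key v
  rw [LinearMap.sum_apply] at this
  simpa only [hg, LinearMap.zero_apply] using this

lemma aux_mul {M : Type*} [CommGroup M] [Finite M] {p : ℕ} [Fact p.Prime]
    (hM : ∀ a : M, a ^ p = 1) (s r k : ℕ) (hcard : Nat.card M = p ^ k) (hk : k + 1 ≤ p ^ r)
    (φ : M →* M) (hφ : ∀ m, φ^[p ^ s] m = m) (m : M) :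
    ∏ i ∈ Finset.range (p ^ r), φ^[i] m = 1 := by
  letI : Module (ZMod p) (Additive M) := AddCommGroup.zmodModule (n := p) (by
    intro x
    exact hM x.toMul)
  exact aux_add (V := Additive M) (MonoidHom.toAdditive φ) s r k hφ hcard hk (Additive.ofMul m)

lemma aux_pow {G : Type*} [Group G] [Finite G] (M : Subgroup G) [M.Normal]
    {p : ℕ} [Fact p.Prime] (hc : ∀ a ∈ M, ∀ b ∈ M, a * b = b * a) (hM : ∀ a ∈ M, a ^ p = 1)
    (s r k : ℕ) (hcard : Nat.card M = p ^ k) (hk : k + 1 ≤ p ^ r) (b m : G) (hm : m ∈ M)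
    (hb : b ^ p ^ s = 1) : (m * b) ^ p ^ r = b ^ p ^ r := by
  letI : CommGroup M :=
    { toGroup := Subgroup.toGroup M, mul_comm := fun a b => Subtype.ext (hc a a.2 b b.2) }
  let φ : M →* M := (MulAut.conjNormal b : MulAut M).toMonoidHom
  have hφ : ∀ (i : ℕ) (x : M), ((φ^[i] x : M) : G) = b ^ i * x * (b ^ i)⁻¹ := by
    intro i x
    induction i with
    | zero => simp
    | succ i ih =>
      rw [Function.iterate_succ_apply']
      change b * _ * b⁻¹ = _
      rw [ih, pow_succ']
      group
  have key := aux_mul (M := M) (fun a => Subtype.ext (hM a a.2)) s r k hcard hk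
    φ (fun x => Subtype.ext (by rw [hφ, hb]; simp)) ⟨m, hm⟩
  have hpow : ∀ j, (m * b) ^ j =
      ((∏ i ∈ Finset.range j, φ^[i] ⟨m, hm⟩ : M) : G) * b ^ j := by
    intro j
    induction j with
    | zero => simp
    | succ j ih =>
      rw [pow_succ, ih, Finset.prod_range_succ]
      change _ = _ * ((φ^[j] ⟨m, hm⟩ : M) : G) * _
      rw [hφ]
      simp [pow_succ, mul_assoc]
  rw [hpow, key]
  simp

/-- The key step: no minimal normal subgroup `M` meets `B` trivially. -/
lemma aux_key {G : Type*} [Group G] [Finite G] (B Y A M : Subgroup G)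
    (hfact : ∀ g : G, ∃ b ∈ B, ∃ y ∈ Y, g = b * y)
    (hYcyc : IsCyclic ↥Y)
    (hYcorefree : ∀ N : Subgroup G, N.Normal → N ≤ Y → N = ⊥)
    (hBcorefree : ∀ N : Subgroup G, N.Normal → N ≤ B → N = ⊥)
    (hAB : A ≤ B)
    (hAnormB : ∀ b ∈ B, ∀ a ∈ A, b * a * b⁻¹ ∈ A)
    (hAmin : ∀ N : Subgroup G, N ≤ B → (∀ b ∈ B, ∀ n ∈ N, b * n * b⁻¹ ∈ N) →
      N ≠ ⊥ → A ≤ N)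
    (hAnonab : ∃ a ∈ A, ∃ a' ∈ A, a * a' ≠ a' * a)
    (hMn : M.Normal) (hMne : M ≠ ⊥)
    (hMmin : ∀ N : Subgroup G, N.Normal → N ≤ M → N ≠ ⊥ → N = M)
    (hMB : ∀ x ∈ M, x ∈ B → x = 1) : False := by
  have hYcomm : ∀ x ∈ Y, ∀ y ∈ Y, x * y = y * x := by
    intro x hx y hy
    letI := IsCyclic.commGroup (α := Y)
    exact congrArg Subtype.val (mul_comm (⟨x, hx⟩ : Y) ⟨y, hy⟩)
  -- `B` and `Y` meet trivially
  have hBY : ∀ x ∈ B, x ∈ Y → x = 1 := by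
    intro x hx hxy
    have h1 : x ∈ B.normalCore := by
      intro g
      obtain ⟨b, hb, y, hy, rfl⟩ := hfact g
      have : b * y * x * (b * y)⁻¹ = b * x * b⁻¹ := by
        rw [mul_assoc b y x, hYcomm y hy x hxy]; group
      rw [this]
      exact B.mul_mem (B.mul_mem hb hx) (B.inv_mem hb)
    rw [hBcorefree _ B.normalCore_normal B.normalCore_le] at h1
    exact h1
  set L := M ⊔ B with hL
  have hLmem : ∀ x, x ∈ L ↔ ∃ m ∈ M, ∃ b ∈ B, m * b = x := fun x =>
    Subgroup.mem_sup_of_normal_left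
  have hML : M ≤ L := le_sup_left
  have hBL : B ≤ L := le_sup_right
  set Y1 := Y ⊓ L with hY1
  -- `|Y1| = |M|`
  have hdec : ∀ m : M, ∃ y : Y1, ∃ b ∈ B, (m : G) = b * y := by
    intro m
    obtain ⟨b, hb, y, hy, h⟩ := hfact m
    refine ⟨⟨y, hy, ?_⟩, b, hb, h⟩
    have : y = b⁻¹ * m := by rw [h]; group
    rw [this]
    exact L.mul_mem (L.inv_mem (hBL hb)) (hML m.2)
  choose f bf hbf hf using hdec
  have hcardY1 : Nat.card Y1 = Nat.card M := by
    refine (Nat.card_congr (Equiv.ofBijective f ⟨?_, ?_⟩)).symm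
    · intro m m' h
      have e1 : (m : G) * (m' : G)⁻¹ = bf m * (bf m')⁻¹ := by
        rw [hf m, hf m', h]; group
      have e2 := hMB _ (M.mul_mem m.2 (M.inv_mem m'.2)) (by
        rw [e1]; exact B.mul_mem (hbf m) (B.inv_mem (hbf m')))
      exact Subtype.ext (mul_inv_eq_one.mp e2)
    · rintro ⟨y, hy, hyL⟩
      obtain ⟨m, hm, b, hb, h⟩ := (hLmem y⁻¹).1 (L.inv_mem hyL)
      have hy' : y = b⁻¹ * m⁻¹ := by rw [← mul_inv_rev, h, inv_inv]
      refine ⟨⟨m⁻¹, M.inv_mem hm⟩, ?_⟩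
      have e0 := hf ⟨m⁻¹, M.inv_mem hm⟩
      set y' := f ⟨m⁻¹, M.inv_mem hm⟩
      set b' := bf ⟨m⁻¹, M.inv_mem hm⟩ with hb'
      have e0' : m⁻¹ = b' * (y' : G) := e0
      have e1 : y * (y' : G)⁻¹ = b⁻¹ * b' := by rw [hy', e0']; group
      have e2 := hBY (y * (y' : G)⁻¹) (by
        rw [e1]; exact B.mul_mem (B.inv_mem hb) (hbf _))
        (Y.mul_mem hy (Y.inv_mem y'.2.1))
      exact Subtype.ext (mul_inv_eq_one.mp e2).symm
  -- `M` is solvable, hence abelian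
  have hMsol : Group.IsSolvable M := by
    set H := M ⊔ Y1 with hH
    have hMH : M ≤ H := le_sup_left
    have hYH : Y1 ≤ H := le_sup_right
    have hHL : H ≤ L := sup_le hML inf_le_right
    have hHs : Group.IsSolvable H := by
      apply aux_ito H (B.subgroupOf H) (Y1.subgroupOf H)
      · rintro ⟨a, haH⟩ ha ⟨b, hbH⟩ hb
        rw [Subgroup.mem_subgroupOf] at ha hb
        simp only at ha hb
        apply Subtype.ext
        change a * b = b * a
        obtain ⟨m, hm, y, hy, h1⟩ := Subgroup.mem_sup_of_normal_left.1 haH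
        obtain ⟨m', hm', y', hy', h2⟩ := Subgroup.mem_sup_of_normal_left.1 hbH
        have e : a * b * a⁻¹ * b⁻¹ = 1 := by
          apply hMB
          · rw [← QuotientGroup.eq_one_iff (N := M), ← h1, ← h2]
            have q1 : (m : G ⧸ M) = 1 := (QuotientGroup.eq_one_iff m).2 hm
            have q2 : (m' : G ⧸ M) = 1 := (QuotientGroup.eq_one_iff m').2 hm'
            simp only [QuotientGroup.mk_mul, QuotientGroup.mk_inv, q1, q2, one_mul]
            rw [← QuotientGroup.mk_mul, hYcomm y hy.1 y' hy'.1, QuotientGroup.mk_mul]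
            group
          · exact B.mul_mem (B.mul_mem (B.mul_mem ha hb) (B.inv_mem ha)) (B.inv_mem hb)
        have e' := mul_inv_eq_one.mp e
        exact mul_inv_eq_iff_eq_mul.1 e'
      · rintro ⟨a, haH⟩ ha ⟨b, hbH⟩ hb
        rw [Subgroup.mem_subgroupOf] at ha hb
        exact Subtype.ext (hYcomm a ha.1 b hb.1)
      · rintro ⟨g, hg⟩
        obtain ⟨b, hb, y, hy, h⟩ := hfact g
        have hy1 : y ∈ Y1 := by
          refine ⟨hy, ?_⟩
          have : y = b⁻¹ * g := by rw [h]; group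
          rw [this]
          exact L.mul_mem (L.inv_mem (hBL hb)) (hHL hg)
        have hbH : b ∈ H := by
          have : b = g * y⁻¹ := by rw [h]; group
          rw [this]
          exact H.mul_mem hg (H.inv_mem (hYH hy1))
        exact ⟨⟨b, hbH⟩, hb, ⟨y, hYH hy1⟩, hy1, Subtype.ext h⟩
    exact Group.isSolvable_of_isSolvable_injective (f := Subgroup.inclusion hMH)
      (Subgroup.inclusion_injective hMH)
  have hMcomm : ∀ a ∈ M, ∀ b ∈ M, a * b = b * a := by
    by_contra hcon
    push Not at hcon
    obtain ⟨a, ha, b, hb, hab⟩ := hcon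
    have h1 : ⁅M, M⁆ ≤ M := Subgroup.commutator_le_left M M
    have h2 : ⁅M, M⁆ ≠ ⊥ := by
      intro h
      have h3 := Subgroup.commutator_mem_commutator ha hb
      rw [h, Subgroup.mem_bot, commutatorElement_eq_one_iff_mul_comm] at h3
      exact hab h3
    have h3 := hMmin _ inferInstance h1 h2
    have : Nontrivial M := (Subgroup.nontrivial_iff_ne_bot M).2 hMne
    have h4 := Group.IsSolvable.commutator_lt_top_of_nontrivial M
    have h5 : (commutator M).map M.subtype = ⁅M, M⁆ := by
      rw [commutator_def, Subgroup.map_commutator, ← MonoidHom.range_eq_map, Subgroup.range_subtype]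
    apply h4.ne
    apply Subgroup.map_injective M.subtype_injective
    rw [h5, h3, ← MonoidHom.range_eq_map, Subgroup.range_subtype]
  -- `M` is elementary abelian
  obtain ⟨p, hp, hpdvd⟩ := Nat.exists_prime_and_dvd
    (n := Nat.card M) (fun h => hMne (Subgroup.card_eq_one.1 h))
  have : Fact p.Prime := ⟨hp⟩
  have hMp : ∀ a ∈ M, a ^ p = 1 := by
    let E : Subgroup G :=
      { carrier := {x | x ∈ M ∧ x ^ p = 1}
        one_mem' := ⟨M.one_mem, one_pow p⟩
        mul_mem' := by
          rintro a b ⟨ha, ha'⟩ ⟨hb, hb'⟩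
          refine ⟨M.mul_mem ha hb, ?_⟩
          have hab : Commute a b := hMcomm a ha b hb
          rw [hab.mul_pow, ha', hb', one_mul]
        inv_mem' := by
          rintro a ⟨ha, ha'⟩
          exact ⟨M.inv_mem ha, by rw [inv_pow, ha', inv_one]⟩ }
    have hEn : E.Normal := by
      constructor
      rintro n ⟨hn, hn'⟩ g
      exact ⟨hMn.conj_mem n hn g, by rw [conj_pow, hn']; group⟩
    have hEne : E ≠ ⊥ := by
      obtain ⟨x, hx⟩ := exists_prime_orderOf_dvd_card' p hpdvd
      intro h
      have h1 : (x : G) ∈ E := ⟨x.2, by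
        rw [← Subgroup.coe_pow, ← hx, pow_orderOf_eq_one]; rfl⟩
      rw [h, Subgroup.mem_bot] at h1
      have : x = 1 := Subtype.ext h1
      rw [this, orderOf_one] at hx
      exact hp.one_lt.ne hx
    have hEM := hMmin E hEn (fun x hx => hx.1) hEne
    intro a ha
    rw [← hEM] at ha
    exact ha.2
  obtain ⟨k, hk⟩ : ∃ k, Nat.card M = p ^ k := by
    apply IsPGroup.iff_card.1
    intro x
    exact ⟨1, Subtype.ext (by rw [pow_one]; exact hMp x x.2)⟩
  have hk0 : k ≠ 0 := by
    rintro rfl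
    exact hMne (Subgroup.card_eq_one.1 (by rw [hk, pow_zero]))
  -- bound on `k`
  have hkp : p ^ (k - 1) ≤ k := by
    by_contra hlt
    push Not at hlt
    have : IsCyclic Y1 := isCyclic_of_injective (Subgroup.inclusion (inf_le_left : Y1 ≤ Y))
      (Subgroup.inclusion_injective _)
    obtain ⟨y, hy⟩ := IsCyclic.exists_ofOrder_eq_natCard (α := Y1)
    rw [hcardY1, hk] at hy
    obtain ⟨m, hm, b, hb, h⟩ := (hLmem (y : G)).1 y.2.2
    have hypk : (y : G) ^ p ^ k = 1 := by
      rw [← Subgroup.coe_pow, ← hy, pow_orderOf_eq_one]; rfl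
    have hbk : b ^ p ^ k = 1 := by
      apply hMB _ _ (B.pow_mem hb _)
      rw [← QuotientGroup.eq_one_iff (N := M), QuotientGroup.mk_pow]
      have q1 : (m : G ⧸ M) = 1 := (QuotientGroup.eq_one_iff m).2 hm
      have q2 : (b : G ⧸ M) = ((y : G) : G ⧸ M) := by
        rw [← h, QuotientGroup.mk_mul, q1, one_mul]
      rw [q2, ← QuotientGroup.mk_pow, hypk]; rfl
    have e := aux_pow M hMcomm hMp k (k - 1) k hk hlt b m hm hbk
    rw [h] at e
    have e1 : (y : G) ^ p ^ (k - 1) = 1 :=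
      hBY _ (by rw [e]; exact B.pow_mem hb _) (Y.pow_mem y.2.1 _)
    have e2 : y ^ p ^ (k - 1) = 1 := Subtype.ext e1
    have e3 := orderOf_dvd_of_pow_eq_one e2
    rw [hy] at e3
    have := (Nat.pow_dvd_pow_iff_le_right hp.one_lt).1 e3
    omega
  have hAut : Group.IsSolvable (MulAut M) := by
    have hk2 : k ≤ 2 := by
      by_contra hk3
      push Not at hk3
      have h1 : 2 ^ (k - 1) ≤ k := (Nat.pow_le_pow_left hp.two_le _).trans hkp
      obtain ⟨j, rfl⟩ : ∃ j, k = j + 3 := ⟨k - 3, by omega⟩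
      have h2 : j < 2 ^ j := Nat.lt_two_pow_self
      have h3 : 2 ^ (j + 3 - 1) = 4 * 2 ^ j := by
        rw [show j + 3 - 1 = j + 2 by omega, pow_add]; ring
      omega
    obtain rfl | rfl : k = 1 ∨ k = 2 := by omega
    · exact aux_mulAutPrime M (by rw [hk, pow_one]; exact hp)
    · have : p = 2 := le_antisymm (by simpa using hkp) hp.two_le
      exact aux_mulAut4 M (by rw [hk, this]; norm_num)
  -- the core of `L`
  set K := L.normalCore with hK
  have hKn : K.Normal := L.normalCore_normal
  have hKL : K ≤ L := L.normalCore_le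
  have hMK : M ≤ K := Subgroup.normal_le_normalCore.2 hML
  have hY1K : Y1 ≤ K := by
    rintro x ⟨hxY, hxL⟩ g
    obtain ⟨b, hb, y, hy, rfl⟩ := hfact g
    have : b * y * x * (b * y)⁻¹ = b * x * b⁻¹ := by
      rw [mul_assoc b y x, hYcomm y hy x hxY]; group
    rw [this]
    exact L.mul_mem (L.mul_mem (hBL hb) hxL) (L.inv_mem (hBL hb))
  have hKB : K ⊓ B ≠ ⊥ := by
    intro h
    have hKM : K ≤ M := by
      intro x hx
      obtain ⟨m, hm, b, hb, rfl⟩ := (hLmem x).1 (hKL hx)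
      have : b ∈ K ⊓ B := ⟨by
        have e : b = m⁻¹ * (m * b) := by group
        rw [e]; exact K.mul_mem (K.inv_mem (hMK hm)) hx, hb⟩
      rw [h, Subgroup.mem_bot] at this
      rw [this, mul_one]; exact hm
    have h1 : Y1 = M := Subgroup.eq_of_le_of_card_ge (hY1K.trans hKM) hcardY1.ge
    exact hMne (hYcorefree M hMn (h1 ▸ inf_le_left))
  have hAK : A ≤ K := (hAmin (K ⊓ B) inf_le_right (by
    rintro b hb n ⟨hnK, hnB⟩
    exact ⟨hKn.conj_mem n hnK b, B.mul_mem (B.mul_mem hb hnB) (B.inv_mem hb)⟩) hKB).trans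
      inf_le_left
  -- `K` is solvable
  set C := K ⊓ (MulAut.conjNormal (H := M)).ker with hC
  have hCM : ∀ c ∈ C, ∀ m ∈ M, c * m = m * c := by
    rintro c ⟨-, hc⟩ m hm
    have := congrArg Subtype.val (DFunLike.congr_fun (MonoidHom.mem_ker.1 hc) (⟨m, hm⟩ : M))
    rw [MulAut.conjNormal_apply] at this
    have h2 : c * m * c⁻¹ = m := this
    exact mul_inv_eq_iff_eq_mul.1 h2
  have hCn : C.Normal := inferInstance
  have hCB : ⁅C, C⁆ ≤ B := by
    rw [Subgroup.commutator_le]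
    intro c hc c' hc'
    obtain ⟨m, hm, b, hb, h⟩ := (hLmem c).1 (hKL hc.1)
    obtain ⟨m', hm', b', hb', h'⟩ := (hLmem c').1 (hKL hc'.1)
    have hbM : ∀ n ∈ M, b * n = n * b := by
      intro n hn
      have e : b = m⁻¹ * c := by rw [← h]; group
      rw [e, mul_assoc, hCM c hc n hn, ← mul_assoc, hMcomm _ (M.inv_mem hm) n hn, mul_assoc]
    have hbM' : ∀ n ∈ M, b' * n = n * b' := by
      intro n hn
      have e : b' = m'⁻¹ * c' := by rw [← h']; group
      rw [e, mul_assoc, hCM c' hc' n hn, ← mul_assoc, hMcomm _ (M.inv_mem hm') n hn, mul_assoc]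
    have e : ⁅c, c'⁆ = ⁅b, b'⁆ := by
      have s1 : ⁅c, c'⁆ = ⁅b, c'⁆ := by
        have t : m * (b * c' * b⁻¹) = (b * c' * b⁻¹) * m := by
          have u1 : Commute m b := (hbM m hm).symm
          have u2 : Commute m c' := (hCM c' hc' m hm).symm
          exact (u1.mul_right u2).mul_right u1.inv_right
        rw [← h]
        calc ⁅m * b, c'⁆ = m * (b * c' * b⁻¹) * m⁻¹ * c'⁻¹ := by
              simp only [commutatorElement_def]; group
          _ = ⁅b, c'⁆ := by rw [t]; simp only [commutatorElement_def]; group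
      have s2 : ⁅b, c'⁆ = ⁅b, b'⁆ := by
        rw [← h']
        calc ⁅b, m' * b'⁆ = (b * m') * b' * b⁻¹ * b'⁻¹ * m'⁻¹ := by
              simp only [commutatorElement_def]; group
          _ = m' * (b * b' * b⁻¹ * b'⁻¹) * m'⁻¹ := by rw [hbM m' hm']; group
          _ = ⁅b, b'⁆ := by
            have u1 : Commute m' b := (hbM m' hm').symm
            have u2 : Commute m' b' := (hbM' m' hm').symm
            have u3 : Commute m' (b * b' * b⁻¹ * b'⁻¹) :=
              ((u1.mul_right u2).mul_right u1.inv_right).mul_right u2.inv_right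
            rw [u3.eq]; simp only [commutatorElement_def]; group
      rw [s1, s2]
    rw [e, commutatorElement_def]
    exact B.mul_mem (B.mul_mem (B.mul_mem hb hb') (B.inv_mem hb)) (B.inv_mem hb')
  have hCC : ⁅C, C⁆ = ⊥ := hBcorefree _ inferInstance hCB
  have hCs : Group.IsSolvable C := by
    apply Group.isSolvable_of_comm
    intro a b
    have h3 := Subgroup.commutator_mem_commutator a.2 b.2
    rw [hCC, Subgroup.mem_bot, commutatorElement_eq_one_iff_mul_comm] at h3
    exact Subtype.ext h3
  have hKs : Group.IsSolvable K := by
    refine Group.isSolvable_of_ker_le_range (Subgroup.inclusion (inf_le_left : C ≤ K))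
      ((MulAut.conjNormal (H := M)).comp K.subtype) ?_
    intro x hx
    exact ⟨⟨x, x.2, hx⟩, rfl⟩
  have hAs : Group.IsSolvable A := Group.isSolvable_of_isSolvable_injective
    (f := Subgroup.inclusion hAK) (Subgroup.inclusion_injective hAK)
  -- contradiction
  obtain ⟨a, ha, a', ha', haa⟩ := hAnonab
  have h1 : ⁅A, A⁆ ≤ A := by
    rw [Subgroup.commutator_le]
    intro x hx y hy
    exact A.mul_mem (A.mul_mem (A.mul_mem hx hy) (A.inv_mem hx)) (A.inv_mem hy)
  have h2 : ⁅A, A⁆ ≠ ⊥ := by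
    intro h
    have h3 := Subgroup.commutator_mem_commutator ha ha'
    rw [h, Subgroup.mem_bot, commutatorElement_eq_one_iff_mul_comm] at h3
    exact haa h3
  have h3 : A ≤ ⁅A, A⁆ := by
    apply hAmin _ (h1.trans hAB) _ h2
    intro b hb n hn
    have : ⁅A, A⁆ ≤ ⁅A, A⁆.comap (MulAut.conj b).toMonoidHom := by
      rw [Subgroup.commutator_le]
      intro x hx y hy
      rw [Subgroup.mem_comap]
      have e : (MulAut.conj b).toMonoidHom ⁅x, y⁆ = ⁅b * x * b⁻¹, b * y * b⁻¹⁆ :=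
        map_commutatorElement (MulAut.conj b).toMonoidHom x y
      rw [e]
      exact Subgroup.commutator_mem_commutator (hAnormB b hb x hx) (hAnormB b hb y hy)
    exact this hn
  have : Nontrivial A := (Subgroup.nontrivial_iff_ne_bot A).2 (by
    rintro rfl
    rw [Subgroup.mem_bot] at ha ha'
    exact haa (by rw [ha, ha']))
  have h4 := Group.IsSolvable.commutator_lt_top_of_nontrivial A
  have h5 : (commutator A).map A.subtype = ⁅A, A⁆ := by
    rw [commutator_def, Subgroup.map_commutator, ← MonoidHom.range_eq_map, Subgroup.range_subtype]
  apply h4.ne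
  apply Subgroup.map_injective A.subtype_injective
  rw [h5, ← MonoidHom.range_eq_map, Subgroup.range_subtype]
  exact le_antisymm h1 h3

/-- Every nontrivial normal subgroup of a finite group contains a minimal one. -/
lemma aux_min {G : Type*} [Group G] [Finite G] (M : Subgroup G) (hn : M.Normal) (hM : M ≠ ⊥) :
    ∃ N : Subgroup G, N ≤ M ∧ N.Normal ∧ N ≠ ⊥ ∧
      ∀ N' : Subgroup G, N'.Normal → N' ≤ N → N' ≠ ⊥ → N' = N := by
  obtain ⟨N, hle, hN⟩ := (Set.toFinite {N : Subgroup G | N.Normal ∧ N ≠ ⊥}).exists_le_minimal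
    (show M ∈ {N : Subgroup G | N.Normal ∧ N ≠ ⊥} from ⟨hn, hM⟩)
  exact ⟨N, hle, hN.prop.1, hN.prop.2, fun N' h1 h2 h3 => le_antisymm h2 (hN.le_of_le ⟨h1, h3⟩ h2)⟩

end Helpers

/-- Let `G = BY` with `B` and `Y` core-free, `B` monolithic with monolith
`A`, and `Y` cyclic. Then `G` has a unique minimal normal subgroup `N`, and `A ≤ N`. -/
theorem stmt_5 {G : Type*} [Group G] [Finite G] (B Y A : Subgroup G)
    (hfact : ∀ g : G, ∃ b ∈ B, ∃ y ∈ Y, g = b * y)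
    (hYcyc : IsCyclic ↥Y)
    (hYcorefree : ∀ N : Subgroup G, N.Normal → N ≤ Y → N = ⊥)
    (hBcorefree : ∀ N : Subgroup G, N.Normal → N ≤ B → N = ⊥)
    (hAB : A ≤ B) (hAne : A ≠ ⊥)
    (hAnormB : ∀ b ∈ B, ∀ a ∈ A, b * a * b⁻¹ ∈ A)
    (hAmin : ∀ N : Subgroup G, N ≤ B → (∀ b ∈ B, ∀ n ∈ N, b * n * b⁻¹ ∈ N) →
      N ≠ ⊥ → A ≤ N)
    (hAnonab : ∃ a ∈ A, ∃ a' ∈ A, a * a' ≠ a' * a) :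
    ∃ N : Subgroup G, N.Normal ∧ N ≠ ⊥ ∧ A ≤ N ∧
      ∀ M : Subgroup G, M.Normal → M ≠ ⊥ → N ≤ M := by
  have key : ∀ M : Subgroup G, M.Normal → M ≠ ⊥ → A ≤ M := by
    intro M hMn hMne
    obtain ⟨M', hle, h1, h2, h3⟩ := aux_min M hMn hMne
    apply hAmin (M ⊓ B) inf_le_right _ _ |>.trans inf_le_left
    · rintro b hb n ⟨hn, hnB⟩
      exact ⟨hMn.conj_mem n hn b, B.mul_mem (B.mul_mem hb hnB) (B.inv_mem hb)⟩
    · intro h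
      refine aux_key B Y A M' hfact hYcyc hYcorefree hBcorefree hAB hAnormB hAmin hAnonab
        h1 h2 h3 (fun x hx hxB => ?_)
      have : x ∈ M ⊓ B := ⟨hle hx, hxB⟩
      rw [h] at this
      exact this
  have htop : (⊤ : Subgroup G) ≠ ⊥ := fun h => hAne (le_bot_iff.1 (h ▸ le_top))
  obtain ⟨N, -, hN, hNne, hNmin⟩ := aux_min (⊤ : Subgroup G) inferInstance htop
  refine ⟨N, hN, hNne, key N hN hNne, fun M hM hMne => ?_⟩
  have hA : A ≤ N ⊓ M := le_inf (key N hN hNne) (key M hM hMne)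
  have h := hNmin (N ⊓ M) inferInstance inf_le_left (fun h => hAne (le_bot_iff.1 (h ▸ hA)))
  exact h ▸ inf_le_right
end
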